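/- arXiv:hep-th/9610137 — 8 statements merged into one kernel-verified Lean document; each statement's English description precedes it below -/
import Mathlib

section
/- Assume moreover p ≥ 3, and let ζ = e^{πi/p} ∈ ℂ. For each integer k ≥ 0 define f_k : (0,∞) → ℂ by f_k(y) = (ζ^{k+1} e^{−ζ y} − ζ^{−k−1} e^{−ζ^{−1} y}) y^k. Then for every z > 0: (ψ_k(z) : ℂ) = (p^{c+1}/(2πi)) · z^{(p−1)(c+1)} · e^z · ∫_0^∞ x^c e^{−x z^p} ( ∫_0^∞ f_k(y) e^{−x y^p} dy ) dx, where both iterated integrals converge absolutely. -/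
open MeasureTheory

/-- The generalized Hänkel function
`ψ_k(z) = (p^{c+1}/Γ(-c)) ∫_1^∞ z^{-c} (uz)^k e^{-(u-1)z} (u^p-1)^{-(c+1)} du`. -/
noncomputable def genHankel (c : ℝ) (p k : ℕ) (z : ℝ) : ℝ :=
  ((p : ℝ) ^ (c + 1) / Real.Gamma (-c)) *
    ∫ u in Set.Ioi (1 : ℝ),
      z ^ (-c) * (u * z) ^ k * Real.exp (-((u - 1) * z)) * (u ^ p - 1) ^ (-(c + 1))

/-- `f_k(y) = (ζ^{k+1} e^{-ζy} − ζ^{-k-1} e^{-ζ⁻¹y}) y^k` with `ζ = e^{πi/p}`. -/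
noncomputable def hankelF (p k : ℕ) (y : ℝ) : ℂ :=
  (Complex.exp (Real.pi * Complex.I / p) ^ (k + 1) *
      Complex.exp (-(Complex.exp (Real.pi * Complex.I / p) * y)) -
    (Complex.exp (Real.pi * Complex.I / p))⁻¹ ^ (k + 1) *
      Complex.exp (-((Complex.exp (Real.pi * Complex.I / p))⁻¹ * y))) * (y : ℂ) ^ k


open Filter Topology in
lemma aux_rotate (g : ℂ → ℂ) (D : ℝ → ℝ) (a b : ℝ) (hab : a ≤ b)
    (hg : ∀ r : ℝ, 0 < r → ∀ θ ∈ Set.Icc a b, DifferentiableAt ℂ g (r * Complex.exp (θ * Complex.I)))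
    (hD : IntegrableOn D (Set.Ioi 0))
    (hbd : ∀ r : ℝ, 0 < r → r ≠ 1 → ∀ θ ∈ Set.Icc a b, ‖g (r * Complex.exp (θ * Complex.I))‖ ≤ D r)
    (h0 : Tendsto (fun r => r * D r) (𝓝[>] 0) (𝓝 0))
    (hinf : Tendsto (fun r => r * D r) atTop (𝓝 0)) :
    ∫ r in Set.Ioi (0 : ℝ), Complex.exp (a * Complex.I) * g (r * Complex.exp (a * Complex.I))
      = ∫ r in Set.Ioi (0 : ℝ), Complex.exp (b * Complex.I) * g (r * Complex.exp (b * Complex.I)) := by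
  set h : ℂ → ℂ := fun s => Complex.exp s * g (Complex.exp s) with hh
  have hexp : ∀ (t θ : ℝ), Complex.exp (t + θ * Complex.I)
      = (Real.exp t : ℂ) * Complex.exp (θ * Complex.I) := by
    intro t θ; rw [Complex.exp_add, Complex.ofReal_exp]
  have hline : ∀ (t θ : ℝ), h (t + θ * Complex.I) =
      |Real.exp t| • (Complex.exp (θ * Complex.I) * g ((Real.exp t : ℝ) * Complex.exp (θ * Complex.I))) := by
    intro t θ
    simp only [hh, hexp, abs_of_pos (Real.exp_pos t), Complex.real_smul, mul_assoc]
  have himg : Real.exp '' Set.univ = Set.Ioi 0 := by rw [Set.image_univ, Real.range_exp]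
  have hcv : ∀ θ : ℝ, ∫ r in Set.Ioi (0 : ℝ), Complex.exp (θ * Complex.I) * g (r * Complex.exp (θ * Complex.I))
      = ∫ t : ℝ, h (t + θ * Complex.I) := by
    intro θ
    rw [← himg, integral_image_eq_integral_abs_deriv_smul MeasurableSet.univ
      (fun x _ => (Real.hasDerivAt_exp x).hasDerivWithinAt) Real.exp_injective.injOn]
    simp only [hline, Measure.restrict_univ]
  have hnorm : ∀ (t θ : ℝ), ‖h (t + θ * Complex.I)‖ = Real.exp t * ‖g ((Real.exp t : ℝ) * Complex.exp (θ * Complex.I))‖ := by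
    intro t θ
    rw [hline, norm_smul, norm_mul, Complex.norm_exp_ofReal_mul_I]
    simp
  have hDint : Integrable (fun t : ℝ => Real.exp t * D (Real.exp t)) := by
    rw [← himg, integrableOn_image_iff_integrableOn_abs_deriv_smul MeasurableSet.univ
      (fun x _ => (Real.hasDerivAt_exp x).hasDerivWithinAt) Real.exp_injective.injOn] at hD
    simpa [IntegrableOn] using hD
  have hdiff : ∀ (t : ℝ), ∀ θ ∈ Set.Icc a b, DifferentiableAt ℂ h (t + θ * Complex.I) := by
    intro t θ hθ
    apply DifferentiableAt.mul (by fun_prop)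
    have := hg (Real.exp t) (Real.exp_pos t) θ hθ
    rw [← hexp] at this
    exact DifferentiableAt.comp (t + θ * Complex.I : ℂ) this (by fun_prop)
  have hlint : ∀ θ ∈ Set.Icc a b, Integrable (fun t : ℝ => h (t + θ * Complex.I)) := by
    intro θ hθ
    refine hDint.mono' ?_ ?_
    · apply Continuous.aestronglyMeasurable
      rw [continuous_iff_continuousAt]
      intro t
      exact ContinuousAt.comp (f := fun t : ℝ => (t + θ * Complex.I : ℂ)) (hdiff t θ hθ).continuousAt (by fun_prop)
    · have : ∀ᵐ t : ℝ, t ≠ 0 := by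
        rw [ae_iff]; simp
      filter_upwards [this] with t ht
      rw [hnorm]
      have := hbd (Real.exp t) (Real.exp_pos t) (by simpa using ht) θ hθ
      gcongr
  have hvert : ∀ (l : Filter ℝ) (e : ℝ → ℝ), (∀ᶠ T in l, e T ≠ 0) →
      Tendsto (fun T => Real.exp (e T) * D (Real.exp (e T))) l (𝓝 0) →
      Tendsto (fun T => ∫ y in a..b, h (e T + y * Complex.I)) l (𝓝 0) := by
    intro l e he hl
    have hl2 := hl.mul_const |b - a|
    rw [zero_mul] at hl2
    refine squeeze_zero_norm' ?_ hl2
    filter_upwards [he] with T hT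
    refine intervalIntegral.norm_integral_le_of_norm_le_const fun y hy => ?_
    rw [Set.uIoc_of_le hab] at hy
    have := hbd (Real.exp (e T)) (Real.exp_pos _) (by simpa using hT) y ⟨hy.1.le, hy.2⟩
    rw [hnorm]
    gcongr
  have hv1 := hvert atTop (fun T => T) (eventually_ne_atTop 0) (hinf.comp Real.tendsto_exp_atTop)
  have hv2 := hvert atTop (fun T => -T) ((eventually_ne_atTop 0).mono (by simp))
    ((h0.comp Real.tendsto_exp_atBot_nhdsGT).comp tendsto_neg_atTop_atBot)
  have hA := intervalIntegral_tendsto_integral (hlint a ⟨le_rfl, hab⟩) tendsto_neg_atTop_atBot tendsto_id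
  have hB := intervalIntegral_tendsto_integral (hlint b ⟨hab, le_rfl⟩) tendsto_neg_atTop_atBot tendsto_id
  have hz := ((hA.sub hB).add (hv1.const_smul Complex.I)).sub (hv2.const_smul Complex.I)
  have hzero : ∀ T : ℝ, (∫ x in -T..T, h (x + a * Complex.I)) - (∫ x in -T..T, h (x + b * Complex.I))
      + Complex.I • (∫ y in a..b, h (T + y * Complex.I))
      - Complex.I • (∫ y in a..b, h (((-T : ℝ) : ℂ) + y * Complex.I)) = 0 := by
    intro T
    have := Complex.integral_boundary_rect_eq_zero_of_differentiableOn h ⟨-T, a⟩ ⟨T, b⟩ ?_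
    · simpa using this
    · intro w hw
      rw [Complex.mem_reProdIm] at hw
      have h2 := hw.2
      simp only [Set.uIcc_of_le hab] at h2
      have := hdiff w.re w.im h2
      rw [Complex.re_add_im] at this
      exact this.differentiableWithinAt
  have hz' := tendsto_nhds_unique hz ((tendsto_const_nhds (x := (0:ℂ))).congr fun T => (hzero T).symm)
  rw [hcv, hcv]
  simpa [sub_eq_zero] using hz'

lemma aux_abs_rpow_int (s : ℝ) (hs : -1 < s) :
    IntegrableOn (fun r : ℝ => |1 - r| ^ s) (Set.Ioc 0 2) := by
  have h1 : IntervalIntegrable (fun r : ℝ => |1 - r| ^ s) volume 0 1 := by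
    have := ((intervalIntegral.intervalIntegrable_rpow' (a := 0) (b := 1) hs).comp_sub_left 1).symm
    simp only [sub_self, sub_zero] at this
    refine this.congr fun r hr => ?_
    rw [Set.uIoc_of_le zero_le_one] at hr
    rw [abs_of_nonneg (by linarith [hr.2])]
  have h2 : IntervalIntegrable (fun r : ℝ => |1 - r| ^ s) volume 1 2 := by
    have := ((intervalIntegral.intervalIntegrable_rpow' (a := 0) (b := 1) hs).comp_sub_right 1)
    norm_num at this
    refine this.congr fun r hr => ?_
    rw [Set.uIoc_of_le one_le_two] at hr
    rw [abs_sub_comm, abs_of_nonneg (by linarith [hr.1])]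
  exact (intervalIntegrable_iff_integrableOn_Ioc_of_le zero_le_two).1 (h1.trans h2)

lemma aux_abs_ge (p : ℕ) (hp : 1 ≤ p) (r : ℝ) (hr : 0 ≤ r) : |1 - r| ≤ |1 - r ^ p| := by
  rcases le_total r 1 with h | h
  · have := pow_le_of_le_one hr h (by omega : p ≠ 0)
    rw [abs_of_nonneg (by linarith), abs_of_nonneg (by linarith)]; linarith
  · have := le_self_pow₀ h (by omega : p ≠ 0)
    rw [abs_of_nonpos (by linarith), abs_of_nonpos (by linarith)]; linarith

lemma aux_pow_exp_int (k : ℕ) (β : ℝ) (hβ : 0 < β) :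
    IntegrableOn (fun r : ℝ => r ^ k * Real.exp (-(β * r))) (Set.Ioi 0) := by
  have := integrableOn_rpow_mul_exp_neg_mul_rpow (p := 1) (s := k) (b := β)
    (by have : (0:ℝ) ≤ k := k.cast_nonneg
        linarith) one_pos hβ
  simpa using this

lemma aux_D_int (s : ℝ) (hs : -1 < s) (hs0 : s < 0) (p k : ℕ) (hp : 1 ≤ p) (β : ℝ) (hβ : 0 < β) :
    IntegrableOn (fun r : ℝ => r ^ k * Real.exp (-(β * r)) * |1 - r ^ p| ^ s) (Set.Ioi 0) := by
  have hunion : Set.Ioi (0:ℝ) = Set.Ioc 0 2 ∪ Set.Ioi 2 := by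
    rw [Set.Ioc_union_Ioi_eq_Ioi]; norm_num
  have hm : Measurable (fun r : ℝ => r ^ k * Real.exp (-(β * r)) * |1 - r ^ p| ^ s) := by
    fun_prop
  rw [hunion]
  refine IntegrableOn.union ?_ ?_
  · refine Integrable.mono' ((aux_abs_rpow_int s hs).const_mul (2 ^ k)) hm.aestronglyMeasurable ?_
    have h1 : ∀ᵐ r : ℝ, r ≠ 1 := by rw [ae_iff]; simp
    filter_upwards [ae_restrict_mem measurableSet_Ioc, ae_restrict_of_ae h1] with r hr hr1
    have hr0 : 0 < r := hr.1
    rw [Real.norm_of_nonneg (by positivity)]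
    have e1 : Real.exp (-(β * r)) ≤ 1 := by
      rw [Real.exp_le_one_iff]; have := mul_pos hβ hr0; linarith
    have e2 : |1 - r ^ p| ^ s ≤ |1 - r| ^ s :=
      Real.rpow_le_rpow_of_nonpos (abs_pos.2 (sub_ne_zero.2 hr1.symm)) (aux_abs_ge p hp r hr0.le) hs0.le
    have e3 : r ^ k ≤ 2 ^ k := pow_le_pow_left₀ hr0.le hr.2 k
    calc r ^ k * Real.exp (-(β * r)) * |1 - r ^ p| ^ s ≤ 2 ^ k * 1 * |1 - r| ^ s := by gcongr
      _ = _ := by ring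
  · refine Integrable.mono' ((aux_pow_exp_int k β hβ).mono_set (Set.Ioi_subset_Ioi zero_le_two)) hm.aestronglyMeasurable ?_
    filter_upwards [ae_restrict_mem measurableSet_Ioi] with r hr
    have hr2 : 2 < r := hr
    have hr0 : 0 < r := by linarith
    rw [Real.norm_of_nonneg (by positivity)]
    have := aux_abs_ge p hp r hr0.le
    rw [abs_of_nonpos (by linarith : 1 - r ≤ 0)] at this
    have e2 : |1 - r ^ p| ^ s ≤ 1 := Real.rpow_le_one_of_one_le_of_nonpos (by linarith) hs0.le
    exact mul_le_of_le_one_right (by positivity) e2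

open Filter Topology in
lemma aux_D_zero (s : ℝ) (p k : ℕ) (hp : 1 ≤ p) (β : ℝ) :
    Tendsto (fun r : ℝ => r * (r ^ k * Real.exp (-(β * r)) * |1 - r ^ p| ^ s)) (𝓝[>] 0) (𝓝 0) := by
  have : ContinuousAt (fun r : ℝ => r * (r ^ k * Real.exp (-(β * r)) * |1 - r ^ p| ^ s)) 0 := by
    have h : ContinuousAt (fun r : ℝ => |1 - r ^ p| ^ s) 0 := by
      apply ContinuousAt.rpow_const (by fun_prop)
      left; rw [zero_pow (by omega)]; norm_num
    fun_prop
  have h2 := this.tendsto.mono_left (nhdsWithin_le_nhds (s := Set.Ioi 0))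
  simpa using h2

open Filter Topology in
lemma aux_D_top (s : ℝ) (hs0 : s < 0) (p k : ℕ) (hp : 1 ≤ p) (β : ℝ) (hβ : 0 < β) :
    Tendsto (fun r : ℝ => r * (r ^ k * Real.exp (-(β * r)) * |1 - r ^ p| ^ s)) atTop (𝓝 0) := by
  have h := tendsto_rpow_mul_exp_neg_mul_atTop_nhds_zero ((k + 1 : ℕ) : ℝ) β hβ
  refine squeeze_zero' ?_ ?_ h
  · filter_upwards [eventually_gt_atTop 0] with r hr
    positivity
  · filter_upwards [eventually_gt_atTop 2] with r hr
    have hr0 : 0 < r := by linarith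
    have := aux_abs_ge p hp r hr0.le
    rw [abs_of_nonpos (by linarith : 1 - r ≤ 0)] at this
    have e2 : |1 - r ^ p| ^ s ≤ 1 := Real.rpow_le_one_of_one_le_of_nonpos (by linarith) hs0.le
    rw [Real.rpow_natCast]
    calc r * (r ^ k * Real.exp (-(β * r)) * |1 - r ^ p| ^ s) 
        ≤ r * (r ^ k * Real.exp (-(β * r)) * 1) := by gcongr
      _ = _ := by rw [pow_succ, neg_mul]; ring

/-- Integrand. -/
noncomputable def auxG (s z : ℝ) (p k : ℕ) (w : ℂ) : ℂ :=
  w ^ k * Complex.exp (-(z * w)) * (1 - w ^ p) ^ (s : ℂ)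

lemma aux_pow_polar (p : ℕ) (r θ : ℝ) : ((r : ℂ) * Complex.exp (θ * Complex.I)) ^ p
    = (r ^ p : ℝ) * Complex.exp ((p * θ : ℝ) * Complex.I) := by
  rw [mul_pow, ← Complex.exp_nat_mul]; push_cast; ring_nf

lemma aux_G_bound (s z : ℝ) (hs0 : s < 0) (hz : 0 < z) (p k : ℕ) (hp : 3 ≤ p) (r : ℝ) (hr : 0 < r)
    (hr1 : r ≠ 1) (θ : ℝ) (hθ : θ ∈ Set.Icc 0 (Real.pi / p)) :
    ‖auxG s z p k (r * Complex.exp (θ * Complex.I))‖ ≤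
      r ^ k * Real.exp (-((z * Real.cos (Real.pi / p)) * r)) * |1 - r ^ p| ^ s := by
  have hp0 : (0:ℝ) < p := by positivity
  have hpi : Real.pi / p ≤ Real.pi := div_le_self Real.pi_pos.le (by exact_mod_cast (by omega : 1 ≤ p))
  have hcos : Real.cos (Real.pi / p) ≤ Real.cos θ := Real.cos_le_cos_of_nonneg_of_le_pi hθ.1 hpi hθ.2
  rw [auxG, norm_mul, norm_mul, norm_pow, norm_mul, Complex.norm_exp_ofReal_mul_I, Complex.norm_exp,
    Complex.norm_cpow_real, mul_one, Complex.norm_of_nonneg hr.le, aux_pow_polar]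
  have hre : (-((z:ℂ) * (r * Complex.exp (θ * Complex.I)))).re = -(z * Real.cos θ * r) := by
    simp [Complex.exp_ofReal_mul_I_re, Complex.exp_ofReal_mul_I_im]; ring
  rw [hre]
  have hge : |1 - r ^ p| ≤ ‖1 - ((r ^ p : ℝ):ℂ) * Complex.exp ((p * θ : ℝ) * Complex.I)‖ := by
    have := abs_norm_sub_norm_le (1:ℂ) (((r ^ p : ℝ):ℂ) * Complex.exp ((p * θ : ℝ) * Complex.I))
    rwa [norm_mul, Complex.norm_exp_ofReal_mul_I, norm_one, mul_one, Complex.norm_of_nonneg (by positivity)] at this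
  have hpos : 0 < |1 - r ^ p| :=
    lt_of_lt_of_le (abs_pos.2 (sub_ne_zero.2 hr1.symm)) (aux_abs_ge p (by omega) r hr.le)
  have := Real.rpow_le_rpow_of_nonpos hpos hge hs0.le
  gcongr

lemma aux_G_diff (s z : ℝ) (p k : ℕ) (hp : 3 ≤ p) (r : ℝ) (hr : 0 < r)
    (θ : ℝ) (hθ : θ ∈ Set.Ioc 0 (Real.pi / p)) :
    DifferentiableAt ℂ (auxG s z p k) (r * Complex.exp (θ * Complex.I)) := by
  have hp0 : (0:ℝ) < p := by positivity
  unfold auxG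
  refine DifferentiableAt.mul (by fun_prop) (DifferentiableAt.cpow_const (by fun_prop) ?_)
  rw [aux_pow_polar, Complex.mem_slitPlane_iff]
  have h1 : (1 - ((r ^ p : ℝ):ℂ) * Complex.exp ((p * θ : ℝ) * Complex.I)).re = 1 - r ^ p * Real.cos (p * θ) := by
    rw [Complex.sub_re, Complex.re_ofReal_mul, Complex.exp_ofReal_mul_I_re, Complex.one_re]
  have h2 : (1 - ((r ^ p : ℝ):ℂ) * Complex.exp ((p * θ : ℝ) * Complex.I)).im = - (r ^ p * Real.sin (p * θ)) := by
    rw [Complex.sub_im, Complex.im_ofReal_mul, Complex.exp_ofReal_mul_I_im, Complex.one_im, zero_sub]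
  rw [h1, h2]
  have hrp : 0 < r ^ p := by positivity
  have hle : p * θ ≤ Real.pi := by have := hθ.2; rw [le_div_iff₀ hp0] at this; linarith
  rcases hle.eq_or_lt with h | h
  · left; rw [h, Real.cos_pi]; linarith
  · right
    have := Real.sin_pos_of_pos_of_lt_pi (mul_pos hp0 hθ.1) h
    have := mul_pos hrp this
    linarith

/-- Boundary value. -/
noncomputable def auxL (s z : ℝ) (p k : ℕ) (r : ℝ) : ℂ :=
  if r < 1 then ((r ^ k * Real.exp (-(z * r)) * (1 - r ^ p) ^ s : ℝ) : ℂ)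
  else ((r ^ k * Real.exp (-(z * r)) * (r ^ p - 1) ^ s : ℝ) : ℂ) * Complex.exp (-(Real.pi * s : ℝ) * Complex.I)

lemma aux_cpow_neg (s : ℝ) (W : ℂ) (hW : 0 < W.im) :
    (1 - W) ^ (s : ℂ) = (W - 1) ^ (s : ℂ) * Complex.exp (-(Real.pi * s : ℝ) * Complex.I) := by
  have him : 0 < (W - 1).im := by simpa using hW
  have h1 : W - 1 ≠ 0 := by intro h; rw [h] at him; simp at him
  have h2 : 1 - W ≠ 0 := by intro h; apply h1; linear_combination -h
  rw [Complex.cpow_def_of_ne_zero h1, Complex.cpow_def_of_ne_zero h2, ← Complex.exp_add]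
  congr 1
  have : 1 - W = -(W - 1) := by ring
  rw [this, Complex.log, Complex.log, norm_neg, Complex.arg_neg_eq_arg_sub_pi_of_im_pos him]
  push_cast; ring

open Filter Topology in
lemma aux_G_lim (s z : ℝ) (p k : ℕ) (hp : 3 ≤ p) (r : ℝ) (hr : 0 < r) (hr1 : r ≠ 1) :
    Tendsto (fun θ : ℝ => Complex.exp (θ * Complex.I) * auxG s z p k (r * Complex.exp (θ * Complex.I)))
      (𝓝[>] 0) (𝓝 (auxL s z p k r)) := by
  have hp0 : (0:ℝ) < p := by positivity
  have hc1 : ContinuousAt (fun θ : ℝ => Complex.exp (θ * Complex.I) * ((r * Complex.exp (θ * Complex.I)) ^ k 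
    * Complex.exp (-(z * (r * Complex.exp (θ * Complex.I)))))) 0 := by fun_prop
  rcases lt_or_gt_of_ne hr1 with h | h
  · have hrp : r ^ p < 1 := pow_lt_one₀ hr.le h (by omega)
    have hc2 : ContinuousAt (fun θ : ℝ => (1 - (r * Complex.exp (θ * Complex.I)) ^ p) ^ (s : ℂ)) 0 := by
      refine ContinuousAt.cpow (by fun_prop) (by fun_prop) ?_
      simp only [Complex.ofReal_zero, zero_mul, Complex.exp_zero, mul_one]
      left
      have : (1 - (r:ℂ) ^ p) = ((1 - r ^ p : ℝ) : ℂ) := by push_cast; ring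
      rw [this, Complex.ofReal_re]; linarith
    have hc := (hc1.mul hc2).tendsto.mono_left (nhdsWithin_le_nhds (s := Set.Ioi 0))
    convert hc using 2
    · simp only [auxG, Pi.mul_apply]; ring
    · simp only [auxL, if_pos h, Pi.mul_apply, Complex.ofReal_zero, zero_mul, Complex.exp_zero, mul_one, one_mul]
      push_cast
      rw [Complex.ofReal_cpow (by linarith)]
      push_cast; rfl
  · have hrp : 1 < r ^ p := one_lt_pow₀ h (by omega)
    have hc2 : ContinuousAt (fun θ : ℝ => ((r * Complex.exp (θ * Complex.I)) ^ p - 1) ^ (s : ℂ)) 0 := by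
      refine ContinuousAt.cpow (by fun_prop) (by fun_prop) ?_
      simp only [Complex.ofReal_zero, zero_mul, Complex.exp_zero, mul_one]
      left
      have : ((r:ℂ) ^ p - 1) = ((r ^ p - 1 : ℝ) : ℂ) := by push_cast; ring
      rw [this, Complex.ofReal_re]; linarith
    have hc := ((hc1.mul hc2).mul_const (Complex.exp (-(Real.pi * s : ℝ) * Complex.I))).tendsto.mono_left (nhdsWithin_le_nhds (s := Set.Ioi 0))
    rw [auxL, if_neg h.not_gt]
    have hev : ∀ᶠ θ : ℝ in 𝓝[>] 0, θ ∈ Set.Ioo 0 (Real.pi / p) :=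
      Ioo_mem_nhdsGT (div_pos Real.pi_pos hp0)
    refine Tendsto.congr' ?_ (hc.trans_eq ?_)
    · filter_upwards [hev] with θ hθ
      have him : 0 < (((r:ℂ) * Complex.exp (θ * Complex.I)) ^ p).im := by
        rw [aux_pow_polar, Complex.im_ofReal_mul, Complex.exp_ofReal_mul_I_im]
        have := hθ.2
        rw [lt_div_iff₀ hp0] at this
        have := Real.sin_pos_of_pos_of_lt_pi (mul_pos hp0 hθ.1) (by linarith)
        positivity
      rw [auxG, aux_cpow_neg s _ him]
      simp only [Pi.mul_apply]
      ring
    · congr 1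
      simp only [Pi.mul_apply, Complex.ofReal_zero, zero_mul, Complex.exp_zero, mul_one, one_mul]
      push_cast
      rw [Complex.ofReal_cpow (by linarith)]
      push_cast; rfl

lemma aux_ae_ne_one : ∀ᵐ r : ℝ ∂(volume.restrict (Set.Ioi 0)), r ≠ 1 := by
  refine ae_restrict_of_ae ?_
  rw [ae_iff]; simp

lemma aux_cos_pos (p : ℕ) (hp : 3 ≤ p) : 0 < Real.cos (Real.pi / p) := by
  have hp3 : (3:ℝ) ≤ p := by exact_mod_cast hp
  have hp0 : (0:ℝ) < p := by positivity
  have hpi := Real.pi_pos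
  refine Real.cos_pos_of_mem_Ioo ⟨?_, ?_⟩
  · have : 0 < Real.pi / p := by positivity
    linarith
  · rw [div_lt_div_iff₀ hp0 two_pos]; nlinarith

lemma aux_G_meas (s z : ℝ) (p k : ℕ) (θ : ℝ) :
    Measurable (fun r : ℝ => Complex.exp (θ * Complex.I) * auxG s z p k (r * Complex.exp (θ * Complex.I))) := by
  unfold auxG
  fun_prop

lemma aux_G_int (s z : ℝ) (hs : -1 < s) (hs0 : s < 0) (hz : 0 < z) (p k : ℕ) (hp : 3 ≤ p)
    (θ : ℝ) (hθ : θ ∈ Set.Icc 0 (Real.pi / p)) :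
    IntegrableOn (fun r : ℝ => Complex.exp (θ * Complex.I) * auxG s z p k (r * Complex.exp (θ * Complex.I)))
      (Set.Ioi 0) := by
  refine Integrable.mono' (aux_D_int s hs hs0 p k (by omega) (z * Real.cos (Real.pi / p))
    (mul_pos hz (aux_cos_pos p hp))) (aux_G_meas s z p k θ).aestronglyMeasurable ?_
  filter_upwards [ae_restrict_mem measurableSet_Ioi, aux_ae_ne_one] with r hr hr1
  rw [norm_mul, Complex.norm_exp_ofReal_mul_I, one_mul]
  exact aux_G_bound s z hs0 hz p k hp r hr hr1 θ hθ

lemma aux_L_int (s z : ℝ) (hs : -1 < s) (hs0 : s < 0) (hz : 0 < z) (p k : ℕ) (hp : 3 ≤ p) :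
    IntegrableOn (auxL s z p k) (Set.Ioi 0) := by
  have hm : Measurable (auxL s z p k) := by
    unfold auxL
    refine Measurable.ite measurableSet_Iio ?_ ?_ <;> fun_prop
  refine Integrable.mono' (aux_D_int s hs hs0 p k (by omega) z hz) hm.aestronglyMeasurable ?_
  filter_upwards [ae_restrict_mem measurableSet_Ioi, aux_ae_ne_one] with r hr hr1
  have hr0 : 0 < r := hr
  rcases lt_or_gt_of_ne hr1 with h | h
  · have hrp : r ^ p < 1 := pow_lt_one₀ hr0.le h (by omega)
    have : 0 < 1 - r ^ p := by linarith
    rw [auxL, if_pos h, Complex.norm_of_nonneg (by positivity), abs_of_pos this]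
  · have hrp : 1 < r ^ p := one_lt_pow₀ h (by omega)
    have : 0 < r ^ p - 1 := by linarith
    rw [auxL, if_neg h.not_gt, norm_mul, ← Complex.ofReal_neg, Complex.norm_exp_ofReal_mul_I, mul_one,
      Complex.norm_of_nonneg (by positivity), abs_sub_comm, abs_of_pos this]

open Filter Topology in
lemma aux_J (s z : ℝ) (hs : -1 < s) (hs0 : s < 0) (hz : 0 < z) (p k : ℕ) (hp : 3 ≤ p) :
    ∫ r in Set.Ioi (0 : ℝ), Complex.exp ((Real.pi / p : ℝ) * Complex.I) *
        auxG s z p k (r * Complex.exp ((Real.pi / p : ℝ) * Complex.I))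
      = ∫ r in Set.Ioi (0 : ℝ), auxL s z p k r := by
  have hp0 : (0:ℝ) < p := by positivity
  have hβ := mul_pos hz (aux_cos_pos p hp)
  have hD := aux_D_int s hs hs0 p k (by omega) _ hβ
  have hev : ∀ᶠ θ : ℝ in 𝓝[>] 0, θ ∈ Set.Ioo 0 (Real.pi / p) :=
    Ioo_mem_nhdsGT (div_pos Real.pi_pos hp0)
  have hlim : Tendsto (fun θ : ℝ => ∫ r in Set.Ioi (0 : ℝ), Complex.exp (θ * Complex.I) *
        auxG s z p k (r * Complex.exp (θ * Complex.I))) (𝓝[>] 0)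
        (𝓝 (∫ r in Set.Ioi (0 : ℝ), auxL s z p k r)) := by
    refine tendsto_integral_filter_of_dominated_convergence _ ?_ ?_ hD ?_
    · exact Eventually.of_forall fun θ => (aux_G_meas s z p k θ).aestronglyMeasurable
    · filter_upwards [hev] with θ hθ
      filter_upwards [ae_restrict_mem measurableSet_Ioi, aux_ae_ne_one] with r hr hr1
      rw [norm_mul, Complex.norm_exp_ofReal_mul_I, one_mul]
      exact aux_G_bound s z hs0 hz p k hp r hr hr1 θ ⟨hθ.1.le, hθ.2.le⟩
    · filter_upwards [ae_restrict_mem measurableSet_Ioi, aux_ae_ne_one] with r hr hr1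
      exact aux_G_lim s z p k hp r hr hr1
  refine tendsto_nhds_unique (tendsto_const_nhds.congr' ?_) hlim
  filter_upwards [hev] with θ hθ
  refine (aux_rotate _ _ θ (Real.pi / p) hθ.2.le ?_ hD ?_
    (aux_D_zero s p k (by omega) _) (aux_D_top s hs0 p k (by omega) _ hβ)).symm
  · intro r hr t ht
    exact aux_G_diff s z p k hp r hr t ⟨hθ.1.trans_le ht.1, ht.2⟩
  · intro r hr hr1 t ht
    exact aux_G_bound s z hs0 hz p k hp r hr hr1 t ⟨hθ.1.le.trans ht.1, ht.2⟩

open ComplexConjugate in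
lemma aux_L_im (s z : ℝ) (hs : -1 < s) (hs0 : s < 0) (hz : 0 < z) (p k : ℕ) (hp : 3 ≤ p) :
    (∫ r in Set.Ioi (0 : ℝ), auxL s z p k r) - conj (∫ r in Set.Ioi (0 : ℝ), auxL s z p k r)
      = ((∫ r in Set.Ioi (1 : ℝ), r ^ k * Real.exp (-(z * r)) * (r ^ p - 1) ^ s : ℝ) : ℂ) *
        (2 * Complex.I * (Real.sin (-(Real.pi * s)) : ℝ)) := by
  have hL := aux_L_int s z hs hs0 hz p k hp
  have hL' : IntegrableOn (fun r => conj (auxL s z p k r)) (Set.Ioi 0) := 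
    (Complex.conjLIE.toContinuousLinearEquiv.toContinuousLinearMap.integrable_comp hL)
  rw [← integral_conj, ← integral_sub hL hL', ← integral_complex_ofReal, ← integral_mul_const,
    ← integral_Ici_eq_integral_Ioi (x := (1:ℝ))]
  have : ∀ r, auxL s z p k r - conj (auxL s z p k r) = (Set.Ici (1:ℝ)).indicator
      (fun r : ℝ => ((r ^ k * Real.exp (-(z * r)) * (r ^ p - 1) ^ s : ℝ) : ℂ) *
        (2 * Complex.I * (Real.sin (-(Real.pi * s)) : ℝ))) r := by
    intro r
    by_cases h : r < 1
    · rw [Set.indicator_of_notMem (by simpa using h), auxL, if_pos h, Complex.conj_ofReal, sub_self]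
    · rw [Set.indicator_of_mem (by simpa using h), auxL, if_neg h, map_mul, Complex.conj_ofReal, ← mul_sub,
        ← Complex.ofReal_neg]
      congr 1
      apply Complex.ext
      · simp only [Complex.sub_re, Complex.conj_re, sub_self, Complex.re_mul_ofReal]
        simp
      · simp only [Complex.sub_im, Complex.conj_im, Complex.exp_ofReal_mul_I_im, Complex.im_mul_ofReal]
        simp
        ring
  simp only [this]
  rw [setIntegral_indicator measurableSet_Ici]
  congr 2
  rw [Set.inter_eq_right]
  exact fun x hx => Set.mem_Ioi.2 (lt_of_lt_of_le one_pos (Set.mem_Ici.1 hx))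

open ComplexConjugate in
lemma aux_hankelF_eq (p k : ℕ) (y : ℝ) :
    hankelF p k y = Complex.exp ((Real.pi / p : ℝ) * Complex.I) ^ (k + 1) *
      Complex.exp (-(Complex.exp ((Real.pi / p : ℝ) * Complex.I) * y)) * (y : ℂ) ^ k
      - conj (Complex.exp ((Real.pi / p : ℝ) * Complex.I) ^ (k + 1) *
      Complex.exp (-(Complex.exp ((Real.pi / p : ℝ) * Complex.I) * y)) * (y : ℂ) ^ k) := by
  have h : (Real.pi * Complex.I / p : ℂ) = (Real.pi / p : ℝ) * Complex.I := by push_cast; ring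
  have hc : conj (Complex.exp ((Real.pi / p : ℝ) * Complex.I)) = (Complex.exp ((Real.pi / p : ℝ) * Complex.I))⁻¹ := by
    rw [← Complex.exp_conj, ← Complex.exp_neg, map_mul, Complex.conj_ofReal, Complex.conj_I, mul_neg]
  simp only [map_mul, map_pow, Complex.conj_ofReal, ← Complex.exp_conj (-_), map_neg, hc]
  rw [hankelF, h]
  ring

lemma aux_one_sub (p : ℕ) (hp : 3 ≤ p) (v : ℝ) :
    1 - ((v : ℂ) * Complex.exp ((Real.pi / p : ℝ) * Complex.I)) ^ p = ((1 + v ^ p : ℝ) : ℂ) := by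
  have hp0 : (p : ℝ) ≠ 0 := by positivity
  rw [aux_pow_polar, mul_div_cancel₀ _ hp0, Complex.exp_pi_mul_I]
  push_cast; ring

open ComplexConjugate in
lemma aux_scale (s z : ℝ) (hz : 0 < z) (p k : ℕ) (hp : 3 ≤ p) (v : ℝ) (hv : 0 < v) :
    hankelF p k (z * v) * (((z ^ p + (z * v) ^ p) ^ s : ℝ) : ℂ) =
    ((z ^ k * z ^ (p * s) : ℝ) : ℂ) * (Complex.exp ((Real.pi / p : ℝ) * Complex.I) *
        auxG s z p k (v * Complex.exp ((Real.pi / p : ℝ) * Complex.I)) -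
      conj (Complex.exp ((Real.pi / p : ℝ) * Complex.I) *
        auxG s z p k (v * Complex.exp ((Real.pi / p : ℝ) * Complex.I)))) := by
  have h1 : (z ^ p + (z * v) ^ p) ^ s = z ^ (p * s) * (1 + v ^ p) ^ s := by
    rw [mul_pow, Real.rpow_mul hz.le, Real.rpow_natCast, ← Real.mul_rpow (by positivity) (by positivity)]
    ring_nf
  rw [aux_hankelF_eq p k, h1, auxG, aux_one_sub p hp, ← Complex.ofReal_cpow (by positivity)]
  simp only [sub_mul, mul_sub]
  have h2 : ∀ A B : ℂ, ∀ x y : ℝ, A * x = y * B → A * x - conj A * x = y * B - y * conj B := by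
    intro A B x y h
    have := congrArg conj h
    simp only [map_mul, Complex.conj_ofReal] at this
    rw [h, this]
  apply h2
  push_cast
  have : (z : ℂ) * (v * Complex.exp (Real.pi / p * Complex.I)) = Complex.exp (Real.pi / p * Complex.I) * (z * v) := by ring
  rw [this]
  ring

lemma aux_hankelF_int (p k : ℕ) (hp : 3 ≤ p) : IntegrableOn (hankelF p k) (Set.Ioi 0) := by
  have hm : Continuous (hankelF p k) := by unfold hankelF; fun_prop
  refine Integrable.mono' ((aux_pow_exp_int k _ (aux_cos_pos p hp)).const_mul 2) hm.aestronglyMeasurable ?_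
  filter_upwards [ae_restrict_mem measurableSet_Ioi] with y hy
  have hy0 : 0 < y := hy
  have hb : ‖Complex.exp ((Real.pi / p : ℝ) * Complex.I) ^ (k + 1) *
      Complex.exp (-(Complex.exp ((Real.pi / p : ℝ) * Complex.I) * y)) * (y : ℂ) ^ k‖ =
      y ^ k * Real.exp (-(Real.cos (Real.pi / p) * y)) := by
    rw [norm_mul, norm_mul, norm_pow, norm_pow, Complex.norm_exp_ofReal_mul_I, one_pow, one_mul,
      Complex.norm_exp, Complex.norm_of_nonneg hy0.le, mul_comm, Complex.neg_re, Complex.re_mul_ofReal,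
      Complex.exp_ofReal_mul_I_re]
  rw [aux_hankelF_eq p k]
  refine (norm_sub_le _ _).trans ?_
  rw [RCLike.norm_conj, hb]
  linarith

open ComplexConjugate in
lemma aux_K (s z : ℝ) (hs : -1 < s) (hs0 : s < 0) (hz : 0 < z) (p k : ℕ) (hp : 3 ≤ p) :
    ∫ y in Set.Ioi (0 : ℝ), hankelF p k y * (((z ^ p + y ^ p) ^ s : ℝ) : ℂ)
     = ((z * (z ^ k * z ^ (p * s)) : ℝ) : ℂ) *
      (((∫ r in Set.Ioi (1 : ℝ), r ^ k * Real.exp (-(z * r)) * (r ^ p - 1) ^ s : ℝ) : ℂ) *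
        (2 * Complex.I * (Real.sin (-(Real.pi * s)) : ℝ))) := by
  have hp0 : (0:ℝ) < p := by positivity
  have h := integral_comp_mul_left_Ioi (fun y : ℝ => hankelF p k y * (((z ^ p + y ^ p) ^ s : ℝ) : ℂ)) 0 hz
  rw [mul_zero] at h
  have hz' : (z : ℂ) ≠ 0 := by exact_mod_cast hz.ne'
  have h2 : ∫ y in Set.Ioi (0 : ℝ), hankelF p k y * (((z ^ p + y ^ p) ^ s : ℝ) : ℂ)
      = z * ∫ v in Set.Ioi (0 : ℝ), hankelF p k (z * v) * (((z ^ p + (z * v) ^ p) ^ s : ℝ) : ℂ) := by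
    rw [h, Complex.real_smul]; push_cast; field_simp
  have hG := aux_G_int s z hs hs0 hz p k hp (Real.pi / p) ⟨by positivity, le_rfl⟩
  have hG' : IntegrableOn (fun r : ℝ => conj (Complex.exp ((Real.pi / p : ℝ) * Complex.I) *
      auxG s z p k (r * Complex.exp ((Real.pi / p : ℝ) * Complex.I)))) (Set.Ioi 0) := (Complex.conjLIE.toContinuousLinearEquiv.toContinuousLinearMap.integrable_comp hG)
  rw [h2, setIntegral_congr_fun measurableSet_Ioi (fun v hv => aux_scale s z hz p k hp v hv),
    integral_const_mul, integral_sub hG hG', integral_conj, aux_J s z hs hs0 hz p k hp, aux_L_im s z hs hs0 hz p k hp]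
  push_cast; ring

theorem statement9 (c : ℝ) (hc₁ : -1 < c) (hc₂ : c < 0) (p : ℕ) (hp : 3 ≤ p) (k : ℕ) :
    ∀ z : ℝ, 0 < z →
      (∀ x : ℝ, x ∈ Set.Ioi (0 : ℝ) →
        IntegrableOn (fun y : ℝ => hankelF p k y * Complex.exp (-(x * y ^ p : ℝ)))
          (Set.Ioi (0 : ℝ))) ∧
      IntegrableOn
        (fun x : ℝ => ((x ^ c : ℝ) : ℂ) * Complex.exp (-(x * z ^ p : ℝ)) *
          ∫ y in Set.Ioi (0 : ℝ), hankelF p k y * Complex.exp (-(x * y ^ p : ℝ)))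
        (Set.Ioi (0 : ℝ)) ∧
      ((genHankel c p k z : ℝ) : ℂ)
        = (((p : ℝ) ^ (c + 1) : ℝ) : ℂ) / (2 * Real.pi * Complex.I) *
            ((z ^ (((p : ℝ) - 1) * (c + 1)) : ℝ) : ℂ) * Complex.exp (z : ℂ) *
            ∫ x in Set.Ioi (0 : ℝ),
              ((x ^ c : ℝ) : ℂ) * Complex.exp (-(x * z ^ p : ℝ)) *
                ∫ y in Set.Ioi (0 : ℝ), hankelF p k y * Complex.exp (-(x * y ^ p : ℝ)) := by
  intro z hz
  have hF := aux_hankelF_int p k hp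
  have hzp : 0 < z ^ p := by positivity
  have hX : IntegrableOn (fun x : ℝ => ((x ^ c : ℝ) : ℂ) * Complex.exp (-(x * z ^ p : ℝ))) (Set.Ioi 0) := by
    have := (integrableOn_rpow_mul_exp_neg_mul_rpow (p := 1) (s := c) (b := z ^ p) hc₁ one_pos hzp).ofReal (𝕜 := ℂ)
    refine this.congr (Filter.Eventually.of_forall fun x => ?_)
    simp [mul_comm]
  have hcont : Continuous (fun q : ℝ × ℝ => Complex.exp (-(q.1 * q.2 ^ p : ℝ))) := by fun_prop
  have hP : Integrable (fun q : ℝ × ℝ => (((q.1 ^ c : ℝ) : ℂ) * Complex.exp (-(q.1 * z ^ p : ℝ))) *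
      (hankelF p k q.2 * Complex.exp (-(q.1 * q.2 ^ p : ℝ))))
      ((volume.restrict (Set.Ioi (0:ℝ))).prod (volume.restrict (Set.Ioi (0:ℝ)))) := by
    have h0 := (Integrable.mul_prod hX hF)
    have hb : ∀ᵐ q : ℝ × ℝ ∂((volume.restrict (Set.Ioi (0:ℝ))).prod (volume.restrict (Set.Ioi (0:ℝ)))),
        ‖Complex.exp (-(q.1 * q.2 ^ p : ℝ))‖ ≤ 1 := by
      rw [Measure.prod_restrict]
      filter_upwards [ae_restrict_mem (measurableSet_Ioi.prod measurableSet_Ioi)] with q hq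
      have h1 : 0 < q.1 := hq.1
      have h2 : 0 < q.2 := hq.2
      rw [← Complex.ofReal_neg, Complex.norm_exp_ofReal, Real.exp_le_one_iff]
      have : 0 < q.1 * q.2 ^ p := by positivity
      linarith
    have h3 := h0.mul_bdd hcont.aestronglyMeasurable hb
    refine h3.congr (Filter.Eventually.of_forall fun q => ?_)
    simp only; ring
  refine ⟨?_, ?_, ?_⟩
  · intro x hx
    have hx0 : 0 < x := hx
    refine Integrable.mul_bdd (c := 1) hF (by fun_prop) ?_
    filter_upwards [ae_restrict_mem measurableSet_Ioi] with y hy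
    have hy0 : 0 < y := hy
    rw [← Complex.ofReal_neg, Complex.norm_exp_ofReal, Real.exp_le_one_iff]
    have : 0 < x * y ^ p := by positivity
    linarith
  · have := hP.integral_prod_left
    simp only [integral_const_mul] at this
    exact this
  · have hsw := integral_integral_swap (f := fun x y : ℝ => (((x ^ c : ℝ) : ℂ) * Complex.exp (-(x * z ^ p : ℝ))) *
      (hankelF p k y * Complex.exp (-(x * y ^ p : ℝ)))) hP
    simp only [integral_const_mul] at hsw
    rw [hsw]
    have hin : ∀ y ∈ Set.Ioi (0:ℝ), (∫ x in Set.Ioi (0:ℝ), (((x ^ c : ℝ) : ℂ) * Complex.exp (-(x * z ^ p : ℝ))) *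
      (hankelF p k y * Complex.exp (-(x * y ^ p : ℝ)))) =
        (Real.Gamma (c + 1) : ℂ) * (hankelF p k y * (((z ^ p + y ^ p) ^ (-(c + 1)) : ℝ) : ℂ)) := by
      intro y hy
      have hy0 : 0 < y := hy
      have hr : 0 < z ^ p + y ^ p := by positivity
      have hg := Real.integral_rpow_mul_exp_neg_mul_Ioi (a := c + 1) (by linarith) hr
      rw [one_div, Real.inv_rpow hr.le, ← Real.rpow_neg hr.le, add_sub_cancel_right] at hg
      have hg' := congrArg (fun t : ℝ => (t : ℂ)) hg
      simp only [← integral_complex_ofReal] at hg'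
      calc _ = ∫ x in Set.Ioi (0:ℝ), hankelF p k y * ((x ^ c * Real.exp (-((z ^ p + y ^ p) * x)) : ℝ) : ℂ) := by
            congr 1; funext x
            have : Real.exp (-((z ^ p + y ^ p) * x)) = Real.exp (-(x * z ^ p)) * Real.exp (-(x * y ^ p)) := by
              rw [← Real.exp_add]; ring_nf
            rw [this]; push_cast; ring
        _ = _ := by rw [integral_const_mul, hg']; push_cast; ring
    rw [setIntegral_congr_fun measurableSet_Ioi hin, integral_const_mul,
      aux_K (-(c + 1)) z (by linarith) (by linarith) hz p k hp]
    have hgen : genHankel c p k z = (p : ℝ) ^ (c + 1) / Real.Gamma (-c) * (z ^ (-c) * z ^ k * Real.exp z *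
        ∫ r in Set.Ioi (1 : ℝ), r ^ k * Real.exp (-(z * r)) * (r ^ p - 1) ^ (-(c + 1))) := by
      rw [genHankel, ← integral_const_mul (z ^ (-c) * z ^ k * Real.exp z)]
      congr 2; funext u
      have : Real.exp (-((u - 1) * z)) = Real.exp z * Real.exp (-(z * u)) := by
        rw [← Real.exp_add]; ring_nf
      rw [this, mul_pow]; ring
    rw [hgen]
    generalize (∫ r in Set.Ioi (1 : ℝ), r ^ k * Real.exp (-(z * r)) * (r ^ p - 1) ^ (-(c + 1))) = Q
    have hzz : z ^ (-c) = z ^ (((p : ℝ) - 1) * (c + 1)) * (z * z ^ (p * (-(c + 1)))) := by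
      nth_rewrite 3 [← Real.rpow_one z]
      rw [← Real.rpow_add hz, ← Real.rpow_add hz]; congr 1; ring
    have hGam := Real.Gamma_mul_Gamma_one_sub (c + 1)
    have hsin : 0 < Real.sin (Real.pi * (c + 1)) := by
      have := Real.pi_pos
      apply Real.sin_pos_of_pos_of_lt_pi <;> nlinarith
    have e1 : 1 - (c + 1) = -c := by ring
    rw [e1] at hGam
    have hG0 : Real.Gamma (-c) ≠ 0 := (Real.Gamma_pos_of_pos (by linarith)).ne'
    have e2 : 1 / Real.Gamma (-c) = Real.Gamma (c + 1) * Real.sin (Real.pi * (c + 1)) / Real.pi := by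
      have := Real.pi_ne_zero
      rw [eq_div_iff hsin.ne'] at hGam
      field_simp; rw [mul_comm (c + 1) Real.pi]; linarith
    have e3 : -(Real.pi * -(c + 1)) = Real.pi * (c + 1) := by ring
    rw [e3, hzz, div_eq_mul_one_div _ (Real.Gamma (-c)), e2]
    have hpi : (Real.pi : ℂ) ≠ 0 := by exact_mod_cast Real.pi_ne_zero
    push_cast
    field_simp
end

section
/- For every integer k ≥ 0 and every z > 0: z ψ_k'(z) − z ψ_k(z) + c ψ_k(z) = k ψ_k(z) − ψ_{k+1}(z). Equivalently, with the operator (A_c f)(z) := z f'(z) − z f(z) + c f(z), one has A_c ψ_k = k ψ_k − ψ_{k+1}. -/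
open MeasureTheory

theorem gh_integrable (c : ℝ) (hc₁ : -1 < c) (hc₂ : c < 0) (p : ℕ) (hp : 2 ≤ p) (k : ℕ)
    (z : ℝ) (hz : 0 < z) :
    IntegrableOn (fun u : ℝ => u ^ k * Real.exp (-((u - 1) * z)) * (u ^ p - 1) ^ (-(c + 1)))
      (Set.Ioi 1) := by
  have h0 : IntegrableOn (fun t : ℝ => t ^ (-(c + 1)) * Real.exp (-(z / 2) * t)) (Set.Ioi 0) := by
    have := integrableOn_rpow_mul_exp_neg_mul_rpow (p := 1) (s := -(c + 1)) (b := z / 2)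
      (by linarith) one_pos (by linarith)
    simpa using this
  have h1 : IntegrableOn (fun u : ℝ => (u - 1) ^ (-(c + 1)) * Real.exp (-(z / 2) * (u - 1)))
      (Set.Ioi 1) := by
    have := ((measurePreserving_sub_right volume (1 : ℝ)).integrableOn_comp_preimage
      (measurableEmbedding_subRight 1)).2 h0
    simpa [Function.comp_def] using this
  have h2 := h1.const_mul ((k.factorial : ℝ) * (2 / z) ^ k * Real.exp (z / 2))
  refine Integrable.mono' h2 (Measurable.aestronglyMeasurable (by fun_prop)) ?_
  refine (ae_restrict_iff' measurableSet_Ioi).2 (Filter.Eventually.of_forall fun u hu => ?_)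
  have hu : 1 < u := hu
  have hup : u ≤ u ^ p := le_self_pow₀ hu.le (by omega)
  have hw : (u ^ p - 1) ^ (-(c + 1)) ≤ (u - 1) ^ (-(c + 1)) :=
    Real.rpow_le_rpow_of_nonpos (by linarith) (by linarith) (by linarith)
  have hw0 : 0 ≤ (u ^ p - 1) ^ (-(c + 1)) := Real.rpow_nonneg (by linarith) _
  have hk : u ^ k ≤ (k.factorial : ℝ) * (2 / z) ^ k * Real.exp (u * z / 2) := by
    have := Real.pow_div_factorial_le_exp (u * z / 2) (by positivity) k
    rw [div_le_iff₀ (by positivity)] at this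
    calc u ^ k = (2 / z) ^ k * (u * z / 2) ^ k := by
          rw [← mul_pow]; congr 1; field_simp
      _ ≤ (2 / z) ^ k * (Real.exp (u * z / 2) * k.factorial) := by gcongr
      _ = _ := by ring
  have hpos : 0 ≤ u ^ k * Real.exp (-((u - 1) * z)) := by positivity
  rw [Real.norm_of_nonneg (mul_nonneg hpos hw0)]
  calc u ^ k * Real.exp (-((u - 1) * z)) * (u ^ p - 1) ^ (-(c + 1))
      ≤ ((k.factorial : ℝ) * (2 / z) ^ k * Real.exp (u * z / 2)) * Real.exp (-((u - 1) * z))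
          * (u - 1) ^ (-(c + 1)) := by gcongr
    _ = (k.factorial : ℝ) * (2 / z) ^ k * (Real.exp (u * z / 2) * Real.exp (-((u - 1) * z)))
          * (u - 1) ^ (-(c + 1)) := by ring
    _ = (k.factorial : ℝ) * (2 / z) ^ k * (Real.exp (z / 2) * Real.exp (-(z / 2) * (u - 1)))
          * (u - 1) ^ (-(c + 1)) := by
        rw [← Real.exp_add, ← Real.exp_add]; congr 3; ring_nf
    _ = _ := by ring

/-- the inner integral -/
noncomputable def ghI (c : ℝ) (p k : ℕ) (z : ℝ) : ℝ :=
  ∫ u in Set.Ioi (1 : ℝ), u ^ k * Real.exp (-((u - 1) * z)) * (u ^ p - 1) ^ (-(c + 1))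

theorem ghI_deriv (c : ℝ) (hc₁ : -1 < c) (hc₂ : c < 0) (p : ℕ) (hp : 2 ≤ p) (k : ℕ)
    (z : ℝ) (hz : 0 < z) :
    HasDerivAt (ghI c p k) (ghI c p k z - ghI c p (k + 1) z) z := by
  have key := hasDerivAt_integral_of_dominated_loc_of_deriv_le
    (μ := volume.restrict (Set.Ioi (1 : ℝ))) (x₀ := z) (s := Set.Ioi (z / 2))
    (F := fun z u => u ^ k * Real.exp (-((u - 1) * z)) * (u ^ p - 1) ^ (-(c + 1)))
    (F' := fun z u => u ^ k * Real.exp (-((u - 1) * z)) * (u ^ p - 1) ^ (-(c + 1))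
      - u ^ (k + 1) * Real.exp (-((u - 1) * z)) * (u ^ p - 1) ^ (-(c + 1)))
    (bound := fun u => u ^ (k + 1) * Real.exp (-((u - 1) * (z / 2))) * (u ^ p - 1) ^ (-(c + 1))
      - u ^ k * Real.exp (-((u - 1) * (z / 2))) * (u ^ p - 1) ^ (-(c + 1)))
    (Ioi_mem_nhds (by linarith))
    (Filter.Eventually.of_forall fun x => Measurable.aestronglyMeasurable (by fun_prop))
    (gh_integrable c hc₁ hc₂ p hp k z hz)
    (Measurable.aestronglyMeasurable (by fun_prop))
    ?_
    ((gh_integrable c hc₁ hc₂ p hp (k + 1) (z / 2) (by linarith)).sub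
      (gh_integrable c hc₁ hc₂ p hp k (z / 2) (by linarith)))
    ?_
  · have h := key.2
    rw [integral_sub (gh_integrable c hc₁ hc₂ p hp k z hz)
      (gh_integrable c hc₁ hc₂ p hp (k + 1) z hz)] at h
    exact h
  · refine (ae_restrict_iff' measurableSet_Ioi).2 (Filter.Eventually.of_forall fun u hu x hx => ?_)
    have hu : 1 < u := hu
    have hx : z / 2 < x := hx
    have hup : u ≤ u ^ p := le_self_pow₀ hu.le (by omega)
    have hw0 : 0 ≤ (u ^ p - 1) ^ (-(c + 1)) := Real.rpow_nonneg (by linarith) _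
    have hu1 : 0 ≤ u - 1 := by linarith
    have e1 : u ^ k * Real.exp (-((u - 1) * x)) * (u ^ p - 1) ^ (-(c + 1))
      - u ^ (k + 1) * Real.exp (-((u - 1) * x)) * (u ^ p - 1) ^ (-(c + 1))
      = -((u - 1) * u ^ k * Real.exp (-((u - 1) * x)) * (u ^ p - 1) ^ (-(c + 1))) := by ring
    have e2 : u ^ (k + 1) * Real.exp (-((u - 1) * (z / 2))) * (u ^ p - 1) ^ (-(c + 1))
      - u ^ k * Real.exp (-((u - 1) * (z / 2))) * (u ^ p - 1) ^ (-(c + 1))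
      = (u - 1) * u ^ k * Real.exp (-((u - 1) * (z / 2))) * (u ^ p - 1) ^ (-(c + 1)) := by ring
    rw [e1, e2, norm_neg, Real.norm_of_nonneg (by positivity)]
    gcongr
  · refine Filter.Eventually.of_forall fun u x hx => ?_
    have h1 : HasDerivAt (fun x : ℝ => -((u - 1) * x)) (-((u - 1) * 1)) x :=
      ((hasDerivAt_id x).const_mul (u - 1)).neg
    have h2 := (h1.exp.const_mul (u ^ k)).mul_const ((u ^ p - 1) ^ (-(c + 1)))
    exact h2.congr_deriv (by ring)

theorem genHankel_eq (c : ℝ) (p k : ℕ) (z : ℝ) :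
    genHankel c p k z = ((p : ℝ) ^ (c + 1) / Real.Gamma (-c)) *
      (z ^ (-c) * z ^ k * ghI c p k z) := by
  unfold genHankel ghI
  rw [← integral_const_mul (z ^ (-c) * z ^ k)]
  congr 1
  refine integral_congr_ae (Filter.Eventually.of_forall fun u => ?_)
  beta_reduce
  rw [mul_pow]
  ring

/-- Lemma 4.2 of the paper.  With `(A_c f)(z) = z f'(z) − z f(z) + c f(z)`,
one has `A_c ψ_k = k ψ_k − ψ_{k+1}`. -/
theorem statement10 (c : ℝ) (hc₁ : -1 < c) (hc₂ : c < 0) (p : ℕ) (hp : 2 ≤ p) (k : ℕ) :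
    ∀ z : ℝ, 0 < z →
      z * deriv (genHankel c p k) z - z * genHankel c p k z + c * genHankel c p k z
        = (k : ℝ) * genHankel c p k z - genHankel c p (k + 1) z := by
  intro z hz
  have hI := ghI_deriv c hc₁ hc₂ p hp k z hz
  have hr : HasDerivAt (fun z : ℝ => z ^ (-c)) (-c * z ^ (-c - 1)) z :=
    Real.hasDerivAt_rpow_const (Or.inl hz.ne')
  have hd := (((hr.mul (hasDerivAt_pow k z)).mul hI).const_mul
    ((p : ℝ) ^ (c + 1) / Real.Gamma (-c)))
  have hg := hd.congr_of_eventuallyEq (Filter.Eventually.of_forall fun z => genHankel_eq c p k z)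
  rw [hg.deriv, genHankel_eq, genHankel_eq]
  have hz1 : z ^ (-c) = z ^ (-c - 1) * z := by
    rw [Real.rpow_sub_one hz.ne']; field_simp
  have hz2 : z * ((k : ℝ) * z ^ (k - 1)) = k * z ^ k := by
    cases k with
    | zero => simp
    | succ n => simp only [Nat.add_sub_cancel]; ring
  simp only [Pi.mul_apply]
  generalize ((p : ℝ) ^ (c + 1) / Real.Gamma (-c)) = C
  rw [hz1]
  generalize z ^ (-c - 1) = R
  linear_combination (C * R * z * ghI c p k z) * hz2
end

section
/- For every integer k ≥ 0 there exist real numbers α_0, α_1, …, α_{k+p} such that z^p ψ_k(z) = Σ_{j=0}^{k+p} α_j ψ_j(z) for all z > 0. In other words, the linear span W = span_ℝ{ψ_0, ψ_1, ψ_2, …} (inside the real vector space of functions on (0,∞)) is invariant under multiplication by z^p. -/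
open MeasureTheory

lemma aux_int1 (z : ℝ) (hz : 0 < z) (n : ℕ) : ∀ s : ℝ, -1 < s →
    IntegrableOn (fun u : ℝ => u ^ n * (u - 1) ^ s * Real.exp (-((u - 1) * z))) (Set.Ioi 1) := by
  induction n with
  | zero =>
    intro s hs
    have h := integrableOn_rpow_mul_exp_neg_mul_rpow (p := 1) (s := s) (b := z) hs one_pos hz
    have h2 := ((measurePreserving_sub_right volume (1 : ℝ)).integrableOn_comp_preimage
      (MeasurableEquiv.subRight (1 : ℝ)).measurableEmbedding).2 h
    have e : (fun x : ℝ => x - 1) ⁻¹' Set.Ioi 0 = Set.Ioi 1 := by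
      ext x; simp
    rw [e] at h2
    refine h2.congr_fun (fun u hu => ?_) measurableSet_Ioi
    simp [mul_comm z]
  | succ n ih =>
    intro s hs
    refine ((ih (s + 1) (by linarith)).add (ih s hs)).congr_fun (fun u hu => ?_) measurableSet_Ioi
    have : (0 : ℝ) < u - 1 := sub_pos.2 hu
    simp only [Pi.add_apply]
    rw [Real.rpow_add_one this.ne']
    ring

lemma aux_int (c : ℝ) (hc₁ : -1 < c) (hc₂ : c < 0) (p : ℕ) (hp : 2 ≤ p) (z : ℝ) (hz : 0 < z)
    (n : ℕ) :
    IntegrableOn (fun u : ℝ => u ^ n * Real.exp (-((u - 1) * z)) * (u ^ p - 1) ^ (-(c + 1)))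
      (Set.Ioi 1) := by
  refine Integrable.mono' (aux_int1 z hz n (-(c + 1)) (by linarith)) ?_ ?_
  · apply Measurable.aestronglyMeasurable
    fun_prop
  · refine (ae_restrict_iff' measurableSet_Ioi).2 (Filter.Eventually.of_forall fun u hu => ?_)
    have hu : (1 : ℝ) < u := hu
    have h1 : u ≤ u ^ p := le_self_pow₀ hu.le (by omega)
    have h2 : (u ^ p - 1) ^ (-(c + 1)) ≤ (u - 1) ^ (-(c + 1)) :=
      Real.rpow_le_rpow_of_nonpos (by linarith) (by linarith) (by linarith)
    have h3 : 0 ≤ (u ^ p - 1) ^ (-(c + 1)) := Real.rpow_nonneg (by linarith) _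
    have h4 : 0 ≤ u := by linarith
    rw [Real.norm_of_nonneg (by positivity)]
    calc _ ≤ u ^ n * Real.exp (-((u - 1) * z)) * (u - 1) ^ (-(c + 1)) := by gcongr
      _ = _ := by ring

/-- the basic integral -/
noncomputable def auxJ (c : ℝ) (p n : ℕ) (z : ℝ) : ℝ :=
  ∫ u in Set.Ioi (1 : ℝ), u ^ n * Real.exp (-((u - 1) * z)) * (u ^ p - 1) ^ (-(c + 1))

lemma auxJ_eq (c : ℝ) (p k : ℕ) (z : ℝ) : genHankel c p k z =
    ((p : ℝ) ^ (c + 1) / Real.Gamma (-c)) * z ^ (-c) * (z ^ k * auxJ c p k z) := by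
  unfold genHankel auxJ
  rw [mul_assoc]
  congr 1
  rw [← integral_const_mul, ← integral_const_mul]
  congr 1
  funext u
  rw [mul_pow]; ring

lemma aux_ibp (c : ℝ) (hc₁ : -1 < c) (hc₂ : c < 0) (p : ℕ) (hp : 2 ≤ p) (z : ℝ) (hz : 0 < z)
    (n : ℕ) : z * (auxJ c p (n + p) z - auxJ c p n z) =
      n * (auxJ c p (n - 1 + p) z - auxJ c p (n - 1) z) + (-c) * p * auxJ c p (n + (p - 1)) z := by
  have I := aux_int c hc₁ hc₂ p hp z hz
  set g : ℕ → ℝ → ℝ := fun n u => u ^ n * Real.exp (-((u - 1) * z)) * (u ^ p - 1) ^ (-(c + 1))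
    with hg
  set f : ℝ → ℝ := fun u => u ^ n * Real.exp (-((u - 1) * z)) * (u ^ p - 1) ^ (-c) with hf
  set f' : ℝ → ℝ := fun u => n * (g (n - 1 + p) u - g (n - 1) u) + (-c) * p * g (n + (p - 1)) u
    - z * (g (n + p) u - g n u) with hf'
  have pos : ∀ u ∈ Set.Ioi (1 : ℝ), 0 < u ^ p - 1 := fun u hu =>
    sub_pos.2 (one_lt_pow₀ hu (by omega))
  have hv : ∀ u ∈ Set.Ioi (1 : ℝ),
      (u ^ p - 1) ^ (-c) = (u ^ p - 1) ^ (-(c + 1)) * (u ^ p - 1) := fun u hu => by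
    rw [← Real.rpow_add_one (pos u hu).ne']; congr 1; ring
  have A : IntegrableOn (fun u => n * (g (n - 1 + p) u - g (n - 1) u)) (Set.Ioi 1) :=
    ((I _).sub (I _)).const_mul _
  have B : IntegrableOn (fun u => (-c) * p * g (n + (p - 1)) u) (Set.Ioi 1) := (I _).const_mul _
  have C : IntegrableOn (fun u => z * (g (n + p) u - g n u)) (Set.Ioi 1) :=
    ((I _).sub (I _)).const_mul _
  have AB : IntegrableOn (fun u => n * (g (n - 1 + p) u - g (n - 1) u)
    + (-c) * p * g (n + (p - 1)) u) (Set.Ioi 1) := A.add B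
  have f'int : IntegrableOn f' (Set.Ioi 1) := AB.sub C
  have fint : IntegrableOn f (Set.Ioi 1) := by
    refine ((I (n + p)).sub (I n)).congr_fun (fun u hu => ?_) measurableSet_Ioi
    simp only [hf, hg, Pi.sub_apply, hv u hu, pow_add]
    ring
  have hderiv : ∀ u ∈ Set.Ioi (1 : ℝ), HasDerivAt f (f' u) u := by
    intro u hu
    have d1 := hasDerivAt_pow n u
    have d2 : HasDerivAt (fun u : ℝ => Real.exp (-((u - 1) * z)))
        (Real.exp (-((u - 1) * z)) * (-(1 * z))) u :=
      ((((hasDerivAt_id u).sub_const 1).mul_const z).neg).exp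
    have d3 := ((hasDerivAt_pow p u).sub_const 1).rpow_const (p := -c) (Or.inl (pos u hu).ne')
    refine ((d1.mul d2).mul d3).congr_deriv ?_
    have e : -c - 1 = -(c + 1) := by ring
    simp only [hf', hg, hv u hu, e, pow_add, Pi.mul_apply]
    ring
  have lim := tendsto_zero_of_hasDerivAt_of_integrableOn_Ioi hderiv f'int fint
  have cont : ContinuousWithinAt f (Set.Ici 1) 1 := by
    apply Continuous.continuousWithinAt
    refine Continuous.mul (by fun_prop) ?_
    exact Continuous.rpow_const (by fun_prop) (fun x => Or.inr (by linarith))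
  have key := integral_Ioi_of_hasDerivAt_of_tendsto cont hderiv f'int lim
  have f1 : f 1 = 0 := by
    simp [hf, Real.zero_rpow (show -c ≠ 0 by linarith)]
  have e : ∫ u in Set.Ioi (1 : ℝ), f' u = n * (auxJ c p (n - 1 + p) z - auxJ c p (n - 1) z)
      + (-c) * p * auxJ c p (n + (p - 1)) z - z * (auxJ c p (n + p) z - auxJ c p n z) := by
    simp only [hf']
    rw [integral_sub AB C, integral_add A B, integral_const_mul, integral_const_mul,
      integral_const_mul, integral_sub (I _) (I _), integral_sub (I _) (I _)]
    rfl
  rw [f1, e] at key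
  linarith

lemma aux_R (c : ℝ) (hc₁ : -1 < c) (hc₂ : c < 0) (p : ℕ) (hp : 2 ≤ p) (n : ℕ) :
    ∃ β : ℕ → ℝ, ∀ z : ℝ, 0 < z →
      z ^ (n + p) * (auxJ c p (n + p) z - auxJ c p n z) =
        ∑ j ∈ Finset.range (n + p), β j * (z ^ j * auxJ c p j z) := by
  obtain ⟨q, rfl⟩ : ∃ q, p = q + 1 := ⟨p - 1, by omega⟩
  induction n with
  | zero =>
    refine ⟨fun j => if j = q then -c * ((q + 1 : ℕ) : ℝ) else 0, fun z hz => ?_⟩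
    have h := aux_ibp c hc₁ hc₂ (q + 1) hp z hz 0
    simp only [Nat.cast_zero, zero_mul, zero_add, Nat.add_sub_cancel] at h
    simp only [ite_mul, zero_mul, Finset.sum_ite_eq', zero_add, Finset.mem_range,
      Nat.lt_succ_self, if_true]
    rw [pow_succ, mul_assoc, h]
    ring
  | succ n ih =>
    obtain ⟨β, hβ⟩ := ih
    refine ⟨fun j => if j = n + (q + 1) then -c * ((q + 1 : ℕ) : ℝ) else (n + 1 : ℝ) * β j,
      fun z hz => ?_⟩
    have h := aux_ibp c hc₁ hc₂ (q + 1) hp z hz (n + 1)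
    simp only [Nat.add_sub_cancel] at h
    have e : n + 1 + (q + 1) = (n + (q + 1)) + 1 := by ring
    have e2 : n + 1 + q = n + (q + 1) := by ring
    rw [e2] at h
    rw [e] at h ⊢
    rw [Finset.sum_range_succ, pow_succ, mul_assoc, h, mul_add]
    simp only [if_true]
    have : ∑ j ∈ Finset.range (n + (q + 1)),
        (if j = n + (q + 1) then -c * ((q + 1 : ℕ) : ℝ) else (n + 1 : ℝ) * β j)
          * (z ^ j * auxJ c (q + 1) j z)
        = (n + 1 : ℝ) * ∑ j ∈ Finset.range (n + (q + 1)), β j * (z ^ j * auxJ c (q + 1) j z) := by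
      rw [Finset.mul_sum]
      refine Finset.sum_congr rfl fun j hj => ?_
      rw [if_neg (Finset.mem_range.1 hj).ne, mul_assoc]
    rw [this, ← hβ z hz]
    push_cast
    ring

/-- Lemma 4.2 of the paper.  The span of the `ψ_k` is invariant under
multiplication by `z^p`: for each `k` there are reals `α₀,…,α_{k+p}` with
`z^p ψ_k(z) = ∑_{j=0}^{k+p} αⱼ ψ_j(z)` for all `z > 0`. -/
theorem statement11 (c : ℝ) (hc₁ : -1 < c) (hc₂ : c < 0) (p : ℕ) (hp : 2 ≤ p) (k : ℕ) :
    ∃ α : ℕ → ℝ, ∀ z : ℝ, 0 < z →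
      z ^ p * genHankel c p k z
        = ∑ j ∈ Finset.range (k + p + 1), α j * genHankel c p j z := by
  obtain ⟨β, hβ⟩ := aux_R c hc₁ hc₂ p hp k
  refine ⟨fun j => if j = k + p then 1 else -β j, fun z hz => ?_⟩
  have h := hβ z hz
  rw [Finset.sum_range_succ]
  simp only [auxJ_eq, if_true]
  set K := ((p : ℝ) ^ (c + 1) / Real.Gamma (-c)) * z ^ (-c)
  have : ∑ j ∈ Finset.range (k + p),
      (if j = k + p then 1 else -β j) * (K * (z ^ j * auxJ c p j z))
      = -K * ∑ j ∈ Finset.range (k + p), β j * (z ^ j * auxJ c p j z) := by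
    rw [Finset.mul_sum]
    refine Finset.sum_congr rfl fun j hj => ?_
    rw [if_neg (Finset.mem_range.1 hj).ne]
    ring
  rw [this, ← h]
  ring
end

section
/- The function Φ satisfies the first-order partial differential equation (x−1)·∂Φ/∂x(x,z) − z·∂Φ/∂z(x,z) + z·Φ(x,z) = 0 for all real x < 1 and z > 0. -/
open MeasureTheory

/-- The wave function at time `0`: `Φ(x,z) = e^{xz} ψ₀((1−x)z)`. -/
noncomputable def wavePhi (c : ℝ) (p : ℕ) (x z : ℝ) : ℝ :=
  Real.exp (x * z) * genHankel c p 0 ((1 - x) * z)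

lemma aux_int_s12 (s b : ℝ) (hs : -1 < s) (hb : 0 < b) :
    IntegrableOn (fun u : ℝ => (u - 1) ^ s * Real.exp (-b * (u - 1))) (Set.Ioi 1) := by
  have h := integrableOn_rpow_mul_exp_neg_mul_rpow (p := 1) hs one_pos hb
  have h2 := (MeasureTheory.measurePreserving_sub_right (volume : Measure ℝ) 1).integrableOn_comp_preimage
    (MeasurableEquiv.subRight (1:ℝ)).measurableEmbedding
    (f := fun x : ℝ => x ^ s * Real.exp (-b * x ^ (1:ℝ))) (s := Set.Ioi 0)
  have h3 := h2.2 h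
  simpa [Function.comp_def] using h3

lemma aux_w (c : ℝ) (hc₁ : -1 < c) (p : ℕ) (hp : 2 ≤ p) (u : ℝ) (hu : 1 < u) :
    0 ≤ (u ^ p - 1) ^ (-(c + 1)) ∧ (u ^ p - 1) ^ (-(c + 1)) ≤ (u - 1) ^ (-(c + 1)) := by
  have h : u ≤ u ^ p := le_self_pow₀ hu.le (by omega)
  exact ⟨Real.rpow_nonneg (by linarith) _,
    Real.rpow_le_rpow_of_nonpos (by linarith) (by linarith) (by linarith)⟩

lemma aux_diff (c : ℝ) (hc₁ : -1 < c) (hc₂ : c < 0) (p : ℕ) (hp : 2 ≤ p) (z : ℝ) (hz : 0 < z) :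
    DifferentiableAt ℝ (fun z : ℝ => ∫ u in Set.Ioi (1 : ℝ),
      Real.exp (-((u - 1) * z)) * (u ^ p - 1) ^ (-(c + 1))) z := by
  have hmeas : ∀ y : ℝ, AEStronglyMeasurable
      (fun u : ℝ => Real.exp (-((u - 1) * y)) * (u ^ p - 1) ^ (-(c + 1)))
      (volume.restrict (Set.Ioi (1:ℝ))) := fun y =>
    (Measurable.aestronglyMeasurable (by fun_prop))
  refine (hasDerivAt_integral_of_dominated_loc_of_deriv_le (μ := volume.restrict (Set.Ioi (1:ℝ)))
    (F := fun z u : ℝ => Real.exp (-((u - 1) * z)) * (u ^ p - 1) ^ (-(c + 1)))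
    (F' := fun z u : ℝ => Real.exp (-((u - 1) * z)) * (-(u - 1)) * (u ^ p - 1) ^ (-(c + 1)))
    (bound := fun u => (u - 1) ^ (-c) * Real.exp (-(z/2) * (u - 1)))
    (s := Set.Ioi (z/2)) (Ioi_mem_nhds (by linarith)) ?_ ?_ ?_ ?_ ?_ ?_).2.differentiableAt
  · exact Filter.Eventually.of_forall hmeas
  · refine Integrable.mono' (aux_int_s12 (-(c+1)) z (by linarith) hz) (hmeas z) ?_
    refine (ae_restrict_iff' measurableSet_Ioi).2 (Filter.Eventually.of_forall fun u hu => ?_)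
    obtain ⟨h1, h2⟩ := aux_w c hc₁ p hp u hu
    rw [Real.norm_of_nonneg (mul_nonneg (Real.exp_pos _).le h1), mul_comm]
    rw [show -((u - 1) * z) = -z * (u - 1) by ring]
    gcongr
  · exact Measurable.aestronglyMeasurable (by fun_prop)
  · refine (ae_restrict_iff' measurableSet_Ioi).2 (Filter.Eventually.of_forall fun u hu y hy => ?_)
    obtain ⟨h1, h2⟩ := aux_w c hc₁ p hp u hu
    have hu0 : 0 < u - 1 := sub_pos.2 hu
    have hy' : z / 2 < y := hy
    have e : (u - 1) ^ (-c) = (u - 1) * (u - 1) ^ (-(c+1)) := by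
      rw [← Real.rpow_one_add' hu0.le (by linarith)]; congr 1; ring
    rw [norm_mul, norm_mul, Real.norm_of_nonneg (Real.exp_pos _).le, Real.norm_of_nonneg h1,
      norm_neg, Real.norm_of_nonneg hu0.le, e]
    have h3 : Real.exp (-((u - 1) * y)) ≤ Real.exp (-(z/2) * (u - 1)) := by
      apply Real.exp_le_exp.2; nlinarith
    calc _ ≤ Real.exp (-(z/2) * (u - 1)) * (u - 1) * (u - 1) ^ (-(c+1)) := by gcongr
      _ = _ := by ring
  · exact aux_int_s12 (-c) (z/2) (by linarith) (by linarith)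
  · refine Filter.Eventually.of_forall fun u y hy => ?_
    have : HasDerivAt (fun y : ℝ => -((u - 1) * y)) (-(u - 1)) y := by
      have h := (hasDerivAt_id y).const_mul (-(u - 1))
      rw [mul_one] at h
      exact h.congr_of_eventuallyEq (Filter.Eventually.of_forall fun t => (neg_mul _ _).symm)
    exact this.exp.mul_const _

lemma aux_psi (c : ℝ) (hc₁ : -1 < c) (hc₂ : c < 0) (p : ℕ) (hp : 2 ≤ p) (z : ℝ) (hz : 0 < z) :
    DifferentiableAt ℝ (genHankel c p 0) z := by
  have : genHankel c p 0 = fun z => ((p : ℝ) ^ (c + 1) / Real.Gamma (-c)) * (z ^ (-c) *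
      ∫ u in Set.Ioi (1 : ℝ), Real.exp (-((u - 1) * z)) * (u ^ p - 1) ^ (-(c + 1))) := by
    funext z
    unfold genHankel
    rw [← integral_const_mul (z ^ (-c))]
    simp only [pow_zero, mul_one, mul_assoc]
  rw [this]
  exact ((differentiableAt_id.rpow_const (Or.inl hz.ne')).mul
    (aux_diff c hc₁ hc₂ p hp z hz)).const_mul _

/-- Eq. (“firstorder”) in the paper.
`(x−1) ∂Φ/∂x − z ∂Φ/∂z + z Φ = 0` for `x < 1`, `z > 0`. -/
theorem statement12 (c : ℝ) (hc₁ : -1 < c) (hc₂ : c < 0) (p : ℕ) (hp : 2 ≤ p) :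
    ∀ x z : ℝ, x < 1 → 0 < z →
      (x - 1) * deriv (fun x' : ℝ => wavePhi c p x' z) x -
          z * deriv (fun z' : ℝ => wavePhi c p x z') z + z * wavePhi c p x z = 0 := by
  intro x z hx hz
  have hd := (aux_psi c hc₁ hc₂ p hp ((1 - x) * z) (mul_pos (by linarith) hz)).hasDerivAt
  have a1 : HasDerivAt (fun x' : ℝ => (1 - x') * z) (-z) x := by
    simpa using ((hasDerivAt_id x).const_sub 1).mul_const z
  have a2 : HasDerivAt (fun z' : ℝ => (1 - x) * z') (1 - x) z := by
    simpa using (hasDerivAt_id z).const_mul (1 - x)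
  have b1 : HasDerivAt (fun x' : ℝ => x' * z) z x := by
    simpa using (hasDerivAt_id x).mul_const z
  have b2 : HasDerivAt (fun z' : ℝ => x * z') x z := by
    simpa using (hasDerivAt_id z).const_mul x
  have e1 := HasDerivAt.comp (h₂ := genHankel c p 0) x hd a1
  have e2 := HasDerivAt.comp (h₂ := genHankel c p 0) z hd a2
  have d1 : HasDerivAt (fun x' : ℝ => wavePhi c p x' z) _ x := b1.exp.mul e1
  have d2 : HasDerivAt (fun z' : ℝ => wavePhi c p x z') _ z := b2.exp.mul e2
  rw [d1.deriv, d2.deriv]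
  simp only [wavePhi, Function.comp]
  ring
end

section
/- For each fixed z > 0, consider the operator D_x acting on smooth functions of x by (D_x f)(x) = (x−1) f'(x), and for a ∈ ℝ write (D_x + a) for the operator f ↦ D_x f + a f. Then for all real x < 1 and z > 0: [ (D_x + c)(D_x + c − 1)⋯(D_x + c − (p−1)) − c·p·(D_x + c)(D_x + c − 1)⋯(D_x + c − (p−2)) ] applied to the function x ↦ Φ(x,z), evaluated at x, equals (x−1)^p z^p Φ(x,z). (This is the equation (L(x−1, ∂/∂x) − z^p) Φ = 0 with L(z,∂/∂z) = z^{−p}( ∏_{i=0}^{p−1}(z ∂/∂z + c − i) − c p ∏_{i=0}^{p−2}(z ∂/∂z + c − i) ).) -/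
open MeasureTheory

/-- Composition of the first-order operators `D_x + a`, `(D_x f)(x) = (x−1) f'(x)`:
`applyDFactors [a₀, a₁, …] f = (D_x + a₀)(D_x + a₁)⋯ f` (the head acts outermost). -/
noncomputable def applyDFactors : List ℝ → (ℝ → ℝ) → ℝ → ℝ
  | [], f => f
  | a :: as, f => fun x =>
      (x - 1) * deriv (applyDFactors as f) x + a * applyDFactors as f x

/-- Integrand of the `k`-th moment. -/
noncomputable def hkI (c : ℝ) (p k : ℕ) (w u : ℝ) : ℝ :=
  u ^ k * Real.exp (-(u * w)) * (u ^ p - 1) ^ (-(c + 1))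

/-- The `k`-th moment. -/
noncomputable def hkM (c : ℝ) (p k : ℕ) (w : ℝ) : ℝ :=
  ∫ u in Set.Ioi (1 : ℝ), hkI c p k w u

lemma hkI_measurable (c : ℝ) (p k : ℕ) (w : ℝ) : Measurable (hkI c p k w) := by
  unfold hkI
  fun_prop

lemma hkI_nonneg (c : ℝ) (p k : ℕ) (w u : ℝ) (hu : 1 < u) : 0 ≤ hkI c p k w u := by
  have : (1:ℝ) ≤ u ^ p := one_le_pow₀ hu.le
  have h2 : 0 ≤ u ^ p - 1 := by linarith
  unfold hkI
  have := Real.rpow_nonneg h2 (-(c+1))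
  positivity

lemma hkI_integrable (c : ℝ) (hc₁ : -1 < c) (hc₂ : c < 0) (p : ℕ) (hp : 2 ≤ p) (k : ℕ)
    (w : ℝ) (hw : 0 < w) : IntegrableOn (hkI c p k w) (Set.Ioi 1) := by
  have h0 : IntegrableOn (fun x : ℝ => x ^ (-(c+1)) * Real.exp (-(w/2) * x ^ (1:ℝ)))
      (Set.Ioi 0) := integrableOn_rpow_mul_exp_neg_mul_rpow (by linarith) one_pos (by positivity)
  have h1 : IntegrableOn (fun u : ℝ => (u-1) ^ (-(c+1)) * Real.exp (-(w/2) * (u-1) ^ (1:ℝ)))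
      (Set.Ioi 1) := by
    have := ((measurePreserving_sub_right volume (1:ℝ)).integrableOn_comp_preimage
      (MeasurableEquiv.subRight (1:ℝ)).measurableEmbedding
      (f := fun x : ℝ => x ^ (-(c+1)) * Real.exp (-(w/2) * x ^ (1:ℝ))) (s := Set.Ioi 0)).2 h0
    simpa [Function.comp_def] using this
  have h2 := h1.const_mul ((k.factorial : ℝ) / (w/2)^k)
  refine Integrable.mono' h2 (hkI_measurable c p k w).aestronglyMeasurable ?_
  filter_upwards [ae_restrict_mem measurableSet_Ioi] with u hu
  have hu : 1 < u := hu
  rw [Real.norm_of_nonneg (hkI_nonneg c p k w u hu)]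
  have e1 : u ^ k ≤ (k.factorial : ℝ) / (w/2)^k * Real.exp (u * (w/2)) := by
    have := Real.pow_div_factorial_le_exp (u * (w/2)) (by positivity) k
    have hk : (0:ℝ) < k.factorial := by positivity
    have hw2 : 0 < (w/2)^k := by positivity
    rw [div_le_iff₀ hk, mul_pow] at this
    rw [div_mul_eq_mul_div, le_div_iff₀ hw2]
    linarith
  have e2 : (u ^ p - 1) ^ (-(c+1)) ≤ (u - 1) ^ (-(c+1)) := by
    apply Real.rpow_le_rpow_of_nonpos (by linarith) _ (by linarith)
    have := le_self_pow₀ hu.le (show p ≠ 0 by omega)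
    linarith
  have e3 : Real.exp (u * (w/2)) * Real.exp (-(u * w)) ≤ Real.exp (-(w/2) * (u-1) ^ (1:ℝ)) := by
    rw [← Real.exp_add, Real.rpow_one]
    apply Real.exp_le_exp.2
    nlinarith
  have hk : (0:ℝ) ≤ (k.factorial : ℝ) / (w/2)^k := by positivity
  have hnn : 0 ≤ (u - 1) ^ (-(c+1)) := Real.rpow_nonneg (by linarith) _
  calc hkI c p k w u ≤ ((k.factorial : ℝ) / (w/2)^k * Real.exp (u * (w/2))) *
        Real.exp (-(u*w)) * (u - 1) ^ (-(c+1)) := by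
        have : (1:ℝ) ≤ u ^ p := one_le_pow₀ hu.le
        have := Real.rpow_nonneg (show 0 ≤ u ^ p - 1 by linarith) (-(c+1))
        unfold hkI; gcongr
    _ = ((k.factorial : ℝ) / (w/2)^k) * ((u - 1) ^ (-(c+1)) *
        (Real.exp (u * (w/2)) * Real.exp (-(u*w)))) := by ring
    _ ≤ _ := by gcongr

lemma hkM_hasDerivAt (c : ℝ) (hc₁ : -1 < c) (hc₂ : c < 0) (p : ℕ) (hp : 2 ≤ p) (k : ℕ)
    (w : ℝ) (hw : 0 < w) : HasDerivAt (hkM c p k) (-(hkM c p (k+1) w)) w := by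
  have hs : Set.Ioi (w/2) ∈ nhds w := Ioi_mem_nhds (by linarith)
  have := (hasDerivAt_integral_of_dominated_loc_of_deriv_le (μ := volume.restrict (Set.Ioi 1))
    (F := fun w u => hkI c p k w u) (F' := fun w u => - hkI c p (k+1) w u)
    (bound := hkI c p (k+1) (w/2)) hs
    (Filter.Eventually.of_forall fun x => (hkI_measurable c p k x).aestronglyMeasurable)
    (hkI_integrable c hc₁ hc₂ p hp k w hw)
    ((hkI_measurable c p (k+1) w).neg.aestronglyMeasurable) ?_
    (hkI_integrable c hc₁ hc₂ p hp (k+1) (w/2) (by positivity)) ?_).2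
  · rw [integral_neg] at this
    exact this
  · filter_upwards [ae_restrict_mem measurableSet_Ioi] with u hu x hx
    have hu : 1 < u := hu
    have hx : w/2 < x := hx
    rw [norm_neg, Real.norm_of_nonneg (hkI_nonneg c p _ x u hu)]
    have : (1:ℝ) ≤ u ^ p := one_le_pow₀ hu.le
    have h2 : 0 ≤ u ^ p - 1 := by linarith
    have := Real.rpow_nonneg h2 (-(c+1))
    unfold hkI
    gcongr
  · filter_upwards [ae_restrict_mem measurableSet_Ioi] with u hu x hx
    unfold hkI
    have h := (((hasDerivAt_id x).const_mul u).neg.exp.const_mul (u^k)).mul_const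
      ((u ^ p - 1) ^ (-(c + 1)))
    refine h.congr_deriv ?_
    simp only [Pi.neg_apply, id]
    ring

lemma hkM_rec (c : ℝ) (hc₁ : -1 < c) (hc₂ : c < 0) (p : ℕ) (hp : 2 ≤ p)
    (w : ℝ) (hw : 0 < w) : w * (hkM c p p w - hkM c p 0 w) = -c * p * hkM c p (p-1) w := by
  have ip := hkI_integrable c hc₁ hc₂ p hp p w hw
  have i0 := hkI_integrable c hc₁ hc₂ p hp 0 w hw
  have i1 := hkI_integrable c hc₁ hc₂ p hp (p-1) w hw
  have hint : IntegrableOn (fun u => -w * (hkI c p p w u - hkI c p 0 w u)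
      + (-c * p) * hkI c p (p-1) w u) (Set.Ioi 1) :=
    ((ip.sub i0).const_mul (-w)).add (i1.const_mul (-c*p))
  have key := integral_Ioi_of_hasDerivAt_of_tendsto (a := (1:ℝ)) (m := 0)
    (f := fun u : ℝ => Real.exp (-(u*w)) * (u^p-1)^(-c))
    (f' := fun u => -w * (hkI c p p w u - hkI c p 0 w u)
      + (-c * p) * hkI c p (p-1) w u) ?_ ?_ hint ?_
  · have hsub : IntegrableOn (fun u => hkI c p p w u - hkI c p 0 w u) (Set.Ioi 1) := ip.sub i0
    rw [integral_add (hsub.const_mul (-w)) (i1.const_mul (-c*p)), integral_const_mul,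
      integral_const_mul, integral_sub ip i0] at key
    simp only [one_pow, sub_self, Real.zero_rpow (show -c ≠ 0 by linarith), mul_zero] at key
    unfold hkM
    linarith
  · apply ContinuousAt.continuousWithinAt
    apply ContinuousAt.mul (by fun_prop)
    apply ContinuousAt.rpow_const (by fun_prop)
    right; linarith
  · intro u hu
    have hu : 1 < u := hu
    have h1 : (1:ℝ) < u ^ p := one_lt_pow₀ hu (by omega)
    have h2 : 0 < u ^ p - 1 := by linarith
    have hd := (((hasDerivAt_id u).mul_const w).neg.exp).mul
      (((hasDerivAt_pow p u).sub_const 1).rpow_const (p := -c) (Or.inl h2.ne'))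
    refine hd.congr_deriv ?_
    have e : (u^p-1)^(-c) = (u^p-1) * (u^p-1)^(-(c+1)) := by
      rw [show -c = 1 + (-(c+1)) by ring, Real.rpow_add h2, Real.rpow_one]
    have e' : -c - 1 = -(c+1) := by ring
    simp only [hkI, id, e, e']
    simp only [Pi.neg_apply, id]
    ring
  · have ht := tendsto_rpow_mul_exp_neg_mul_atTop_nhds_zero (p:ℝ) w hw
    refine squeeze_zero' ?_ ?_ ht
    · filter_upwards [Filter.eventually_gt_atTop 1] with u hu
      have h1 : (1:ℝ) < u ^ p := one_lt_pow₀ hu (by omega)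
      have := Real.rpow_nonneg (show 0 ≤ u^p-1 by linarith) (-c)
      positivity
    · filter_upwards [Filter.eventually_gt_atTop 1] with u hu
      have h1 : (1:ℝ) < u ^ p := one_lt_pow₀ hu (by omega)
      have e : (u^p-1)^(-c) ≤ u^p := by
        calc (u^p-1)^(-c) ≤ (u^p)^(-c) :=
              Real.rpow_le_rpow (by linarith) (by linarith) (by linarith)
          _ ≤ (u^p)^(1:ℝ) := Real.rpow_le_rpow_of_exponent_le h1.le (by linarith)
          _ = u^p := Real.rpow_one _
      rw [Real.rpow_natCast, mul_comm, show -(u*w) = -w*u by ring]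
      gcongr

/-- Basis functions. -/
noncomputable def hkE (A c : ℝ) (p : ℕ) (z : ℝ) (j : ℕ) (x : ℝ) : ℝ :=
  A * (1 - x) ^ (-c) * ((x - 1) * z) ^ j * hkM c p j ((1 - x) * z)

lemma hkE_deriv (A c : ℝ) (hc₁ : -1 < c) (hc₂ : c < 0) (p : ℕ) (hp : 2 ≤ p) (z : ℝ)
    (hz : 0 < z) (j : ℕ) (x : ℝ) (hx : x < 1) :
    ∃ d, HasDerivAt (hkE A c p z j) d x ∧
      (x - 1) * d = (j - c) * hkE A c p z j x + hkE A c p z (j+1) x := by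
  have hy : 0 < 1 - x := by linarith
  have h1 : HasDerivAt (fun x : ℝ => 1 - x) (-1) x := by
    simpa using (hasDerivAt_id x).const_sub 1
  have h2 := h1.rpow_const (p := -c) (Or.inl hy.ne')
  have h3 : HasDerivAt (fun x : ℝ => ((x-1)*z)^j) _ x :=
    (((hasDerivAt_id x).sub_const 1).mul_const z).pow j
  have h4 : HasDerivAt (fun x : ℝ => hkM c p j ((1-x)*z)) _ x :=
    HasDerivAt.comp (h₂ := hkM c p j) x
      (hkM_hasDerivAt c hc₁ hc₂ p hp j ((1-x)*z) (by positivity)) (h1.mul_const z)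
  refine ⟨_, ((h2.const_mul A).mul h3).mul h4, ?_⟩
  have e : (1-x)^(-c) = (1-x) * (1-x)^(-c-1) := by
    rw [Real.rpow_sub_one hy.ne']; field_simp
  have e2 : (j:ℝ) * ((x-1)*z)^(j-1) * ((x-1)*z) = j * ((x-1)*z)^j := by
    rcases j with _ | j
    · simp
    · simp [pow_succ]; ring
  simp only [hkE, e, id, Pi.mul_apply]
  linear_combination (A * (1-x) * (1-x)^(-c-1) * hkM c p j ((1-x)*z)) * e2

open Polynomial in
/-- Evaluate a polynomial on a sequence of functions. -/
noncomputable def hkEv (E : ℕ → ℝ → ℝ) : ℝ[X] →ₗ[ℝ] (ℝ → ℝ) :=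
  Polynomial.lsum (fun j => LinearMap.toSpanSingleton ℝ (ℝ → ℝ) (E j))

lemma hkEv_monomial (E : ℕ → ℝ → ℝ) (n : ℕ) (a : ℝ) :
    hkEv E (Polynomial.monomial n a) = a • E n := by
  simp [hkEv, Polynomial.sum_monomial_index]

open Polynomial in
/-- Formal counterpart of `D + c`. -/
noncomputable def hkT : Module.End ℝ ℝ[X] :=
  LinearMap.mulLeft ℝ X + LinearMap.mulLeft ℝ X * Polynomial.derivative

lemma hkT_monomial (n : ℕ) (a : ℝ) : hkT (Polynomial.monomial n a) =
    Polynomial.monomial (n+1) a + Polynomial.monomial n (n * a) := by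
  rcases n with _ | n
  · simp [hkT, Polynomial.X_mul_C, Polynomial.C_mul_X_eq_monomial]
  · simp [hkT, Polynomial.derivative_monomial, Polynomial.X_mul_monomial, mul_comm]

lemma hkEv_deriv (c : ℝ) (E : ℕ → ℝ → ℝ)
    (hE : ∀ j x, x < 1 → ∃ d, HasDerivAt (E j) d x ∧
      (x - 1) * d = (j - c) * E j x + E (j+1) x) (P : Polynomial ℝ) (x : ℝ) (hx : x < 1) :
    ∃ d, HasDerivAt (hkEv E P) d x ∧
      (x - 1) * d = hkEv E (hkT P) x - c * hkEv E P x := by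
  induction P using Polynomial.induction_on' with
  | add P Q hP hQ =>
    obtain ⟨d, h1, h2⟩ := hP
    obtain ⟨d', h1', h2'⟩ := hQ
    refine ⟨d + d', ?_, ?_⟩
    · rw [map_add]; exact h1.add h1'
    · simp only [map_add, Pi.add_apply]; linear_combination h2 + h2'
  | monomial n a =>
    obtain ⟨d, h1, h2⟩ := hE n x hx
    refine ⟨a * d, ?_, ?_⟩
    · rw [hkEv_monomial]; exact h1.const_mul a
    · rw [hkT_monomial, map_add]
      simp only [hkEv_monomial, Pi.add_apply, Pi.smul_apply, smul_eq_mul]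
      linear_combination a * h2

lemma hk_apply (c : ℝ) (E : ℕ → ℝ → ℝ)
    (hE : ∀ j x, x < 1 → ∃ d, HasDerivAt (E j) d x ∧
      (x - 1) * d = (j - c) * E j x + E (j+1) x) (P : Polynomial ℝ) (f : ℝ → ℝ)
    (hf : ∀ x < 1, f x = hkEv E P x) (l : List ℕ) :
    ∀ x < 1, applyDFactors (l.map fun i : ℕ => c - (i:ℝ)) f x =
      hkEv E ((l.map fun i : ℕ => hkT - algebraMap ℝ (Module.End ℝ (Polynomial ℝ)) (i:ℝ)).prod P) x := by
  induction l with
  | nil => simpa [applyDFactors] using hf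
  | cons i l ih =>
    intro x hx
    simp only [List.map_cons, applyDFactors, List.prod_cons, Module.End.mul_apply]
    set Q := (l.map fun i : ℕ => hkT - algebraMap ℝ (Module.End ℝ (Polynomial ℝ)) (i:ℝ)).prod P
    have hev : applyDFactors (l.map fun i : ℕ => c - (i:ℝ)) f =ᶠ[nhds x] hkEv E Q := by
      filter_upwards [Iio_mem_nhds hx] with y hy using ih y hy
    obtain ⟨d, h1, h2⟩ := hkEv_deriv c E hE Q x hx
    rw [hev.deriv_eq, h1.deriv, ih x hx, h2]
    simp only [LinearMap.sub_apply, Module.algebraMap_end_apply, map_sub, map_smul, Pi.sub_apply,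
      Pi.smul_apply, smul_eq_mul]
    ring

lemma hkT_prod (n : ℕ) : ((List.range n).map
    fun i : ℕ => hkT - algebraMap ℝ (Module.End ℝ (Polynomial ℝ)) (i:ℝ)).prod
      (Polynomial.monomial 0 1) = Polynomial.monomial n 1 := by
  induction n with
  | zero => simp
  | succ n ih =>
    rw [List.prod_range_succ]
    have hcomm : Commute (hkT - algebraMap ℝ (Module.End ℝ (Polynomial ℝ)) (n:ℝ))
      ((List.range n).map
        fun i : ℕ => hkT - algebraMap ℝ (Module.End ℝ (Polynomial ℝ)) (i:ℝ)).prod := by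
      apply Commute.list_prod_right
      intro y hy
      obtain ⟨i, -, rfl⟩ := List.mem_map.1 hy
      exact ((Commute.refl hkT).sub_left (Algebra.commutes _ _)).sub_right
        ((Algebra.commutes (i:ℝ) _).symm)
    rw [← hcomm.eq, Module.End.mul_apply, ih, LinearMap.sub_apply, hkT_monomial]
    simp [Polynomial.smul_monomial]

lemma wavePhi_eq (c : ℝ) (p : ℕ) (z : ℝ) (hz : 0 < z) (x : ℝ) (hx : x < 1) :
    wavePhi c p x z =
      hkE ((p : ℝ) ^ (c + 1) / Real.Gamma (-c) * Real.exp z * z ^ (-c)) c p z 0 x := by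
  have hy : 0 < 1 - x := by linarith
  unfold wavePhi genHankel hkE hkM
  rw [Real.mul_rpow hy.le hz.le]
  have : ∀ u : ℝ, (1-x)^(-c) * z^(-c) * (u * ((1-x)*z))^0 * Real.exp (-((u-1)*((1-x)*z))) *
      (u^p-1)^(-(c+1)) = ((1-x)^(-c) * z^(-c) * Real.exp ((1-x)*z)) * hkI c p 0 ((1-x)*z) u := by
    intro u
    have : Real.exp (-((u-1)*((1-x)*z))) = Real.exp ((1-x)*z) * Real.exp (-(u*((1-x)*z))) := by
      rw [← Real.exp_add]; ring_nf
    rw [this]; unfold hkI; ring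
  simp_rw [this]
  rw [integral_const_mul]
  have e : Real.exp z = Real.exp (x*z) * Real.exp ((1-x)*z) := by
    rw [← Real.exp_add]; ring_nf
  rw [e]; ring

/-- first equation of (1.3a) in the paper.
`[ (D_x+c)(D_x+c−1)⋯(D_x+c−(p−1)) − cp (D_x+c)⋯(D_x+c−(p−2)) ] Φ(·,z) (x)
  = (x−1)^p z^p Φ(x,z)` for `x < 1`, `z > 0`. -/
theorem statement13 (c : ℝ) (hc₁ : -1 < c) (hc₂ : c < 0) (p : ℕ) (hp : 2 ≤ p) :
    ∀ x z : ℝ, x < 1 → 0 < z →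
      applyDFactors ((List.range p).map fun i => c - (i : ℝ))
          (fun x' : ℝ => wavePhi c p x' z) x -
        c * (p : ℝ) *
          applyDFactors ((List.range (p - 1)).map fun i => c - (i : ℝ))
            (fun x' : ℝ => wavePhi c p x' z) x
      = (x - 1) ^ p * z ^ p * wavePhi c p x z := by
  intro x z hx hz
  set A := (p : ℝ) ^ (c + 1) / Real.Gamma (-c) * Real.exp z * z ^ (-c) with hA
  have hE := fun j x hx => hkE_deriv A c hc₁ hc₂ p hp z hz j x hx
  have hf : ∀ x < 1, (fun x' => wavePhi c p x' z) x =
      hkEv (hkE A c p z) (Polynomial.monomial 0 1) x := by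
    intro x hx
    rw [hkEv_monomial, one_smul]
    exact wavePhi_eq c p z hz x hx
  have hl : ∀ n : ℕ, (List.map (fun i => c - i) (do let a ← List.range n; pure (a:ℝ))) =
      (List.range n).map fun i : ℕ => c - (i:ℝ) := by
    intro n
    simp [List.map_flatMap, ← List.map_eq_flatMap]
  rw [hl, hl]
  rw [hk_apply c _ hE _ _ hf _ x hx, hk_apply c _ hE _ _ hf _ x hx, hkT_prod, hkT_prod,
    hkEv_monomial, hkEv_monomial, one_smul, one_smul, wavePhi_eq c p z hz x hx, ← hA]
  have hr := hkM_rec c hc₁ hc₂ p hp ((1-x)*z) (mul_pos (by linarith) hz)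
  obtain ⟨q, rfl⟩ : ∃ q, p = q + 1 := ⟨p - 1, by omega⟩
  simp only [hkE, Nat.add_sub_cancel] at hr ⊢
  rw [← mul_pow]
  linear_combination (-A * (1-x)^(-c) * ((x-1)*z)^q) * hr
end

section
/- For each fixed x < 1, consider the operator S_z acting on smooth functions of z > 0 by (S_z f)(z) = z f'(z) − z f(z), and for a ∈ ℝ write (S_z + a) for the operator f ↦ S_z f + a f. Then for all real x < 1 and z > 0: [ (S_z + c)(S_z + c − 1)⋯(S_z + c − (p−1)) − c·p·(S_z + c)(S_z + c − 1)⋯(S_z + c − (p−2)) ] applied to the function z ↦ Φ(x,z), evaluated at z, equals z^p (x−1)^p Φ(x,z). (This is the equation (L(z, ∂/∂z − 1) − (x−1)^p) Φ = 0 with L(z,∂/∂z) = z^{−p}( ∏_{i=0}^{p−1}(z ∂/∂z + c − i) − c p ∏_{i=0}^{p−2}(z ∂/∂z + c − i) ).) -/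
open MeasureTheory

/-- Composition of the first-order operators `S_z + a`, `(S_z f)(z) = z f'(z) − z f(z)`:
`applySFactors [a₀, a₁, …] f = (S_z + a₀)(S_z + a₁)⋯ f` (the head acts outermost). -/
noncomputable def applySFactors : List ℝ → (ℝ → ℝ) → ℝ → ℝ
  | [], f => f
  | a :: as, f => fun z =>
      z * deriv (applySFactors as f) z - z * applySFactors as f z +
        a * applySFactors as f z

section helpers14

open Polynomial

noncomputable def LL (c : ℝ) (p k : ℕ) (s : ℝ) : ℝ :=
  ∫ u in Set.Ioi (1 : ℝ), u ^ k * Real.exp (-(u * s)) * (u ^ p - 1) ^ (-(c + 1))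

lemma LL_meas (c : ℝ) (p k : ℕ) (s : ℝ) :
    Measurable (fun u : ℝ => u ^ k * Real.exp (-(u * s)) * (u ^ p - 1) ^ (-(c + 1))) := by
  fun_prop

lemma LL_int (c : ℝ) (hc₁ : -1 < c) (hc₂ : c < 0) (p : ℕ) (hp : 2 ≤ p) (k : ℕ) (s : ℝ)
    (hs : 0 < s) :
    IntegrableOn (fun u : ℝ => u ^ k * Real.exp (-(u * s)) * (u ^ p - 1) ^ (-(c + 1)))
      (Set.Ioi 1) := by
  have h0 : IntegrableOn (fun v : ℝ => v ^ (-(c + 1)) * Real.exp (-(s / 2) * v)) (Set.Ioi 0) := by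
    have := integrableOn_rpow_mul_exp_neg_mul_rpow (p := 1) (s := -(c + 1)) (b := s / 2)
      (by linarith) (by norm_num) (by linarith)
    simpa using this
  have h1 : IntegrableOn (fun u : ℝ => (u - 1) ^ (-(c + 1)) * Real.exp (-(s / 2) * (u - 1)))
      (Set.Ioi 1) := by
    have := ((measurePreserving_sub_right (volume : Measure ℝ) 1).integrableOn_comp_preimage
      (MeasurableEquiv.subRight (1 : ℝ)).measurableEmbedding).2 h0
    have hset : (fun u : ℝ => u - 1) ⁻¹' Set.Ioi 0 = Set.Ioi 1 := by
      ext u; simp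
    rw [hset] at this
    exact this
  have h2 := h1.const_mul ((k.factorial : ℝ) / (s / 2) ^ k)
  refine Integrable.mono' h2 (LL_meas c p k s).aestronglyMeasurable ?_
  refine (ae_restrict_iff' measurableSet_Ioi).2 (Filter.Eventually.of_forall fun u hu => ?_)
  have hu : 1 < u := hu
  have hup : u ≤ u ^ p := le_self_pow₀ hu.le (by omega)
  have hw : (u ^ p - 1) ^ (-(c + 1)) ≤ (u - 1) ^ (-(c + 1)) :=
    Real.rpow_le_rpow_of_nonpos (by linarith) (by linarith) (by linarith)
  have hw0 : 0 ≤ (u ^ p - 1) ^ (-(c + 1)) := Real.rpow_nonneg (by linarith) _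
  have hk : u ^ k ≤ (k.factorial : ℝ) / (s / 2) ^ k * Real.exp (u * (s / 2)) := by
    have := Real.pow_div_factorial_le_exp (x := u * (s / 2)) (by positivity) k
    rw [div_le_iff₀ (by positivity), mul_pow] at this
    rw [div_mul_eq_mul_div, le_div_iff₀ (by positivity)]
    linarith
  rw [Real.norm_of_nonneg (by positivity)]
  have he : Real.exp (u * (s / 2)) * Real.exp (-(u * s)) ≤ Real.exp (-(s / 2) * (u - 1)) := by
    rw [← Real.exp_add]
    apply Real.exp_le_exp.2
    nlinarith
  calc _ ≤ ((k.factorial : ℝ) / (s / 2) ^ k * Real.exp (u * (s / 2))) * Real.exp (-(u * s)) *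
        (u - 1) ^ (-(c + 1)) := by gcongr
    _ = ((k.factorial : ℝ) / (s / 2) ^ k) * ((u - 1) ^ (-(c + 1)) *
        (Real.exp (u * (s / 2)) * Real.exp (-(u * s)))) := by ring
    _ ≤ _ := by
      have : 0 ≤ (u - 1) ^ (-(c + 1)) := Real.rpow_nonneg (by linarith) _
      gcongr

lemma LL_deriv (c : ℝ) (hc₁ : -1 < c) (hc₂ : c < 0) (p : ℕ) (hp : 2 ≤ p) (k : ℕ) (s : ℝ)
    (hs : 0 < s) : HasDerivAt (LL c p k) (-(LL c p (k + 1) s)) s := by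
  have hnhds : Set.Ioi (s / 2) ∈ nhds s := Ioi_mem_nhds (by linarith)
  have := (hasDerivAt_integral_of_dominated_loc_of_deriv_le (μ := volume.restrict (Set.Ioi (1:ℝ)))
    (F := fun s u => u ^ k * Real.exp (-(u * s)) * (u ^ p - 1) ^ (-(c + 1)))
    (F' := fun s u => -(u ^ (k + 1) * Real.exp (-(u * s)) * (u ^ p - 1) ^ (-(c + 1))))
    (x₀ := s) (s := Set.Ioi (s / 2))
    (bound := fun u => u ^ (k + 1) * Real.exp (-(u * (s / 2))) * (u ^ p - 1) ^ (-(c + 1)))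
    hnhds (Filter.Eventually.of_forall fun t => (LL_meas c p k t).aestronglyMeasurable)
    (LL_int c hc₁ hc₂ p hp k s hs) (LL_meas c p (k + 1) s).neg.aestronglyMeasurable
    ?_ (LL_int c hc₁ hc₂ p hp (k + 1) (s / 2) (by linarith)) ?_).2
  · rw [integral_neg] at this
    exact this
  · refine (ae_restrict_iff' measurableSet_Ioi).2 (Filter.Eventually.of_forall fun u hu t ht => ?_)
    have hu : 1 < u := hu
    have ht : s / 2 < t := ht
    have hup : u ≤ u ^ p := le_self_pow₀ hu.le (by omega)
    have hw0 : 0 ≤ (u ^ p - 1) ^ (-(c + 1)) := Real.rpow_nonneg (by linarith) _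
    rw [norm_neg, Real.norm_of_nonneg (by positivity)]
    gcongr
  · refine Filter.Eventually.of_forall fun u t ht => ?_
    have h1 : HasDerivAt (fun t : ℝ => -(u * t)) (-(u * 1)) t :=
      ((hasDerivAt_id t).const_mul u).neg
    have := ((h1.exp.const_mul (u ^ k)).mul_const ((u ^ p - 1) ^ (-(c + 1))))
    refine this.congr_deriv ?_
    ring

lemma LL_parts (c : ℝ) (hc₁ : -1 < c) (hc₂ : c < 0) (p : ℕ) (hp : 2 ≤ p) (s : ℝ)
    (hs : 0 < s) : s * (LL c p p s - LL c p 0 s) = -(c * p) * LL c p (p - 1) s := by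
  have i1 := LL_int c hc₁ hc₂ p hp p s hs
  have i0 := LL_int c hc₁ hc₂ p hp 0 s hs
  have i2 := LL_int c hc₁ hc₂ p hp (p - 1) s hs
  have hI : IntegrableOn (fun u : ℝ =>
      (-s) * (u ^ p * Real.exp (-(u * s)) * (u ^ p - 1) ^ (-(c + 1))
        - u ^ 0 * Real.exp (-(u * s)) * (u ^ p - 1) ^ (-(c + 1)))
        + (-(c * p)) * (u ^ (p - 1) * Real.exp (-(u * s)) * (u ^ p - 1) ^ (-(c + 1))))
      (Set.Ioi 1) := ((i1.sub i0).const_mul (-s)).add (i2.const_mul (-(c * p)))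
  have key := integral_Ioi_of_hasDerivAt_of_tendsto (a := 1) (m := 0)
    (f := fun u : ℝ => Real.exp (-(u * s)) * (u ^ p - 1) ^ (-c))
    (f' := fun u : ℝ => (-s) * (u ^ p * Real.exp (-(u * s)) * (u ^ p - 1) ^ (-(c + 1))
        - u ^ 0 * Real.exp (-(u * s)) * (u ^ p - 1) ^ (-(c + 1)))
        + (-(c * p)) * (u ^ (p - 1) * Real.exp (-(u * s)) * (u ^ p - 1) ^ (-(c + 1))))
    ?_ ?_ hI ?_
  · have e : (∫ u in Set.Ioi (1:ℝ), ((-s) * (u ^ p * Real.exp (-(u * s)) * (u ^ p - 1) ^ (-(c + 1))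
        - u ^ 0 * Real.exp (-(u * s)) * (u ^ p - 1) ^ (-(c + 1)))
        + (-(c * p)) * (u ^ (p - 1) * Real.exp (-(u * s)) * (u ^ p - 1) ^ (-(c + 1)))))
        = (-s) * (LL c p p s - LL c p 0 s) + (-(c * p)) * LL c p (p - 1) s := by
      unfold LL
      rw [← integral_sub i1 i0, ← integral_const_mul, ← integral_const_mul]
      exact integral_add ((i1.sub i0).const_mul (-s)) (i2.const_mul (-(c * p)))
    rw [e] at key
    have hz : (0:ℝ) ^ (-c) = 0 := Real.zero_rpow (by linarith)
    simp only [one_pow, sub_self, hz, mul_zero] at key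
    linarith
  · apply Continuous.continuousWithinAt
    have : Continuous fun u : ℝ => (u ^ p - 1) ^ (-c) :=
      (by fun_prop : Continuous fun u : ℝ => u ^ p - 1).rpow_const (fun _ => Or.inr (by linarith))
    fun_prop
  · intro u hu
    have hu : 1 < u := hu
    have hup : u ≤ u ^ p := le_self_pow₀ hu.le (by omega)
    have hpos : 0 < u ^ p - 1 := by linarith
    have h1 : HasDerivAt (fun t : ℝ => -(t * s)) (-(1 * s)) u :=
      ((hasDerivAt_id u).mul_const s).neg
    have h2 := ((hasDerivAt_pow p u).sub_const 1).rpow_const (p := -c) (Or.inl hpos.ne')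
    have h3 := h1.exp.mul h2
    refine h3.congr_deriv ?_
    have hw : (u ^ p - 1) ^ (-c) = (u ^ p - 1) * (u ^ p - 1) ^ (-(c + 1)) := by
      rw [← Real.rpow_one_add' hpos.le (by linarith)]
      congr 1; ring
    have hw2 : -c - 1 = -(c + 1) := by ring
    rw [hw, hw2]
    ring
  · have h0 : Filter.Tendsto (fun u : ℝ => u ^ p * Real.exp (-s * u)) Filter.atTop (nhds 0) := by
      have := tendsto_rpow_mul_exp_neg_mul_atTop_nhds_zero (p : ℝ) s hs
      simpa using this
    refine squeeze_zero' ?_ ?_ h0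
    · filter_upwards [Filter.eventually_gt_atTop 1] with u hu
      have hup : u ≤ u ^ p := le_self_pow₀ hu.le (by omega)
      have : 0 ≤ (u ^ p - 1) ^ (-c) := Real.rpow_nonneg (by linarith) _
      positivity
    · filter_upwards [Filter.eventually_gt_atTop 1] with u hu
      have hup : u ≤ u ^ p := le_self_pow₀ hu.le (by omega)
      have h1 : (u ^ p - 1) ^ (-c) ≤ (u ^ p) ^ (-c) :=
        Real.rpow_le_rpow (by linarith) (by linarith) (by linarith)
      have h2 : (u ^ p) ^ (-c) ≤ (u ^ p) ^ (1 : ℝ) :=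
        Real.rpow_le_rpow_of_exponent_le (by linarith) (by linarith)
      rw [Real.rpow_one] at h2
      rw [mul_comm, show -(u * s) = -s * u by ring]
      gcongr
      linarith

/-- The function of `z` attached to a polynomial. -/
noncomputable def FP (K c : ℝ) (p : ℕ) (y : ℝ) (P : ℝ[X]) (z : ℝ) : ℝ :=
  K * (Real.exp z * z ^ (-c)) * P.sum (fun k a => a * ((y * z) ^ k * LL c p k (y * z)))

lemma FP_add (K c : ℝ) (p : ℕ) (y : ℝ) (P Q : ℝ[X]) (z : ℝ) :
    FP K c p y (P + Q) z = FP K c p y P z + FP K c p y Q z := by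
  unfold FP
  rw [Polynomial.sum_add_index _ _ _ (by simp) (by intros; ring)]
  ring

lemma FP_monomial (K c : ℝ) (p : ℕ) (y : ℝ) (k : ℕ) (a z : ℝ) :
    FP K c p y (monomial k a) z =
      K * (Real.exp z * z ^ (-c)) * (a * ((y * z) ^ k * LL c p k (y * z))) := by
  unfold FP
  rw [Polynomial.sum_monomial_index _ _ (by simp)]

/-- The operator on polynomials. -/
noncomputable def TP (a : ℝ) (P : ℝ[X]) : ℝ[X] :=
  X * derivative P - X * P + C a * P

lemma TP_comm (a b : ℝ) (P : ℝ[X]) : TP a (TP b P) = TP b (TP a P) := by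
  simp only [TP, derivative_add, derivative_sub, derivative_mul, derivative_X, derivative_C]
  ring

lemma TP_add (a : ℝ) (P Q : ℝ[X]) : TP a (P + Q) = TP a P + TP a Q := by
  simp only [TP, derivative_add]
  ring

lemma TP_monomial (a : ℝ) (k : ℕ) (b : ℝ) :
    TP a (monomial k b) = monomial k ((k + a) * b) + monomial (k + 1) (-b) := by
  have h : X * derivative (monomial k b) = monomial k (k * b) := by
    cases k with
    | zero => simp
    | succ n => rw [derivative_monomial, X_mul_monomial]; simp [mul_comm]
  rw [TP, h, X_mul_monomial, C_mul_monomial, add_mul, LinearMap.map_add, LinearMap.map_neg]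
  abel

lemma FP_deriv (K c : ℝ) (hc₁ : -1 < c) (hc₂ : c < 0) (p : ℕ) (hp : 2 ≤ p) (y : ℝ) (hy : 0 < y)
    (P : ℝ[X]) (a z : ℝ) (hz : 0 < z) :
    ∃ d, HasDerivAt (FP K c p y P) d z ∧
      z * d - z * FP K c p y P z + a * FP K c p y P z = FP K c p y (TP (a - c) P) z := by
  induction P using Polynomial.induction_on' with
  | add P Q h1 h2 =>
    obtain ⟨d1, h1, e1⟩ := h1
    obtain ⟨d2, h2, e2⟩ := h2
    refine ⟨d1 + d2, ?_, ?_⟩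
    · have := h1.add h2
      refine this.congr_of_eventuallyEq (Filter.Eventually.of_forall fun t => ?_)
      exact FP_add ..
    · rw [TP_add, FP_add, FP_add, ← e1, ← e2]; ring
  | monomial k b =>
    have hL := LL_deriv c hc₁ hc₂ p hp k (y * z) (by positivity)
    have hyz : HasDerivAt (fun t : ℝ => y * t) (y * 1) z := (hasDerivAt_id z).const_mul y
    have hL2 := hL.comp z hyz
    have hpw := hyz.pow k
    have hr := Real.hasDerivAt_rpow_const (x := z) (p := -c) (Or.inl hz.ne')
    have h := (((Real.hasDerivAt_exp z).mul hr).const_mul K).mul ((hpw.mul hL2).const_mul b)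
    refine ⟨_, h.congr_of_eventuallyEq (Filter.Eventually.of_forall fun t => ?_), ?_⟩
    · rw [FP_monomial]; rfl
    · rw [TP_monomial, FP_add, FP_monomial, FP_monomial, FP_monomial]
      have e1 : z ^ (-c) = z * z ^ (-c - 1) := by
        rw [Real.rpow_sub_one hz.ne']; field_simp
      simp only [Pi.mul_apply, Pi.pow_apply, Function.comp_apply]
      have e2 : (k : ℝ) * (y * z) ^ (k - 1) * (y * z) = k * (y * z) ^ k := by
        cases k with
        | zero => simp
        | succ n => simp [pow_succ]; ring
      rw [e1]
      generalize LL c p k (y * z) = A at *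
      generalize LL c p (k + 1) (y * z) = B at *
      linear_combination K * Real.exp z * (z * z ^ (-c - 1)) * b * A * e2

lemma apply_FP (K c : ℝ) (hc₁ : -1 < c) (hc₂ : c < 0) (p : ℕ) (hp : 2 ≤ p) (y : ℝ) (hy : 0 < y)
    (f : ℝ → ℝ) (P : ℝ[X]) (hf : ∀ z, 0 < z → f z = FP K c p y P z) (l : List ℝ) :
    ∀ z, 0 < z → applySFactors l f z = FP K c p y (l.foldr (fun a Q => TP (a - c) Q) P) z := by
  induction l with
  | nil => exact hf
  | cons a l ih =>
    intro z hz
    obtain ⟨d, hd, e⟩ := FP_deriv K c hc₁ hc₂ p hp y hy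
      (l.foldr (fun a Q => TP (a - c) Q) P) a z hz
    have hev : applySFactors l f =ᶠ[nhds z] FP K c p y (l.foldr (fun a Q => TP (a - c) Q) P) := by
      filter_upwards [Ioi_mem_nhds hz] with t ht using ih t ht
    rw [List.foldr_cons, ← e, applySFactors]
    beta_reduce
    rw [hev.deriv_eq, hd.deriv, ih z hz]

lemma foldr_TP_comm (c b : ℝ) (l : List ℝ) (P : ℝ[X]) :
    l.foldr (fun a Q => TP (a - c) Q) (TP b P) = TP b (l.foldr (fun a Q => TP (a - c) Q) P) := by
  induction l with
  | nil => rfl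
  | cons a l ih => rw [List.foldr_cons, ih, TP_comm, List.foldr_cons]

lemma foldr_range (c : ℝ) (n : ℕ) :
    ((List.range n).map fun i : ℕ => c - (i : ℝ)).foldr (fun a Q => TP (a - c) Q) (monomial 0 1)
      = monomial n ((-1) ^ n) := by
  induction n with
  | zero => simp
  | succ n ih =>
    rw [List.range_succ, List.map_append, List.foldr_append, List.map_singleton, List.foldr_cons,
      List.foldr_nil, foldr_TP_comm, ih, TP_monomial]
    simp [pow_succ]

end helpers14

/-- second equation of (1.3a) in the paper.
`[ (S_z+c)(S_z+c−1)⋯(S_z+c−(p−1)) − cp (S_z+c)⋯(S_z+c−(p−2)) ] Φ(x,·) (z)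
  = z^p (x−1)^p Φ(x,z)` for `x < 1`, `z > 0`. -/
theorem statement14 (c : ℝ) (hc₁ : -1 < c) (hc₂ : c < 0) (p : ℕ) (hp : 2 ≤ p) :
    ∀ x z : ℝ, x < 1 → 0 < z →
      applySFactors ((List.range p).map fun i => c - (i : ℝ))
          (fun z' : ℝ => wavePhi c p x z') z -
        c * (p : ℝ) *
          applySFactors ((List.range (p - 1)).map fun i => c - (i : ℝ))
            (fun z' : ℝ => wavePhi c p x z') z
      = z ^ p * (x - 1) ^ p * wavePhi c p x z := by
  intro x z hx hz
  have hy : 0 < 1 - x := by linarith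
  have hf : ∀ t, 0 < t → (fun z' : ℝ => wavePhi c p x z') t =
      FP ((p : ℝ) ^ (c + 1) / Real.Gamma (-c) * (1 - x) ^ (-c)) c p (1 - x)
        (Polynomial.monomial 0 1) t := by
    intro t ht
    rw [FP_monomial]
    simp only [wavePhi, genHankel, LL]
    have e : ∀ u : ℝ, ((1 - x) * t) ^ (-c) * (u * ((1 - x) * t)) ^ 0 *
        Real.exp (-((u - 1) * ((1 - x) * t))) * (u ^ p - 1) ^ (-(c + 1)) =
        ((1 - x) ^ (-c) * t ^ (-c) * Real.exp ((1 - x) * t)) *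
        (u ^ 0 * Real.exp (-(u * ((1 - x) * t))) * (u ^ p - 1) ^ (-(c + 1))) := by
      intro u
      rw [Real.mul_rpow hy.le ht.le, show -((u - 1) * ((1 - x) * t)) =
        (1 - x) * t + -(u * ((1 - x) * t)) by ring, Real.exp_add]
      ring
    simp only [e]
    rw [integral_const_mul]
    have e2 : Real.exp t = Real.exp (x * t) * Real.exp ((1 - x) * t) := by
      rw [← Real.exp_add]; congr 1; ring
    rw [e2]
    ring
  have hl : ∀ n : ℕ, ((List.range n).map fun i => c - (i : ℝ)) =
      (List.range n).map (fun i : ℕ => c - (i : ℝ)) := by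
    intro n
    simp [List.map_map, Function.comp_def, ← List.map_eq_flatMap]
  rw [hl, hl]
  rw [apply_FP _ c hc₁ hc₂ p hp (1 - x) hy _ _ hf _ z hz,
    apply_FP _ c hc₁ hc₂ p hp (1 - x) hy _ _ hf _ z hz, foldr_range, foldr_range]
  have h0 := hf z hz
  simp only at h0
  rw [h0, FP_monomial, FP_monomial, FP_monomial]
  have hparts := LL_parts c hc₁ hc₂ p hp ((1 - x) * z) (by positivity)
  obtain ⟨n, rfl⟩ : ∃ n, p = n + 1 := ⟨p - 1, by omega⟩
  simp only [Nat.add_sub_cancel] at hparts ⊢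
  have e3 : (x - 1) ^ (n + 1) = (-1) ^ (n + 1) * (1 - x) ^ (n + 1) := by
    rw [← mul_pow]; congr 1; ring
  rw [e3, mul_pow, mul_pow]
  generalize LL c (n + 1) (n + 1) ((1 - x) * z) = A at *
  generalize LL c (n + 1) n ((1 - x) * z) = B at *
  generalize LL c (n + 1) 0 ((1 - x) * z) = D at *
  generalize (((n + 1 : ℕ) : ℝ) ^ (c + 1) / Real.Gamma (-c) * (1 - x) ^ (-c)) = K at *
  linear_combination (K * (Real.exp z * z ^ (-c)) * (-1) ^ (n + 1) * (1 - x) ^ n * z ^ n) * hparts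
end

section
/- Let p ≥ 1 be an integer and let F(s) = κ·∏_{i=1}^p (s − c_i) be a complex polynomial of degree p with κ ≠ 0 and roots c_1, …, c_p ∈ ℂ (with multiplicity). Assume the genericity condition (G): for every integer m not divisible by p, the multiset {c_1 + m, …, c_p + m} and the multiset {c_1, …, c_p} have distinct images in ℂ/pℤ under the natural projection π_p : ℂ → ℂ/pℤ (as multisets). Let n ≥ 1 be an integer, let ℓ = lcm(p, n), and suppose there exists a nonzero rational function G(s) ∈ ℂ(s) such that ∏_{i=0}^{ℓ/p − 1} F(s − i p) = ∏_{j=0}^{ℓ/n − 1} G(s − j n) as elements of the field ℂ(s). Then p divides n (and consequently ℓ = n and G(s) = ∏_{i=0}^{n/p − 1} F(s − i p)). -/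
open Polynomial
open scoped BigOperators


/-- Images of roots in the quotient. -/
noncomputable def rootImg (S : AddSubgroup ℂ) (P : Polynomial ℂ) : Multiset (ℂ ⧸ S) :=
  P.roots.map (fun z => (QuotientAddGroup.mk z : ℂ ⧸ S))

lemma roots_shift (P : Polynomial ℂ) (a : ℂ) :
    (P.comp (X - C a)).roots = P.roots.map (fun z => z + a) := by
  classical
  have h : P.comp (X - C a) = P.comp (X + C (-a)) := by simp [sub_eq_add_neg]
  ext x
  rw [Polynomial.count_roots, h, Polynomial.rootMultiplicity_eq_rootMultiplicity,
    Polynomial.comp_assoc]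
  have e : x = (x - a) + a := by ring
  rw [e, Multiset.count_map_eq_count' _ _ (add_left_injective a), Polynomial.count_roots,
    Polynomial.rootMultiplicity_eq_rootMultiplicity (p := P)]
  congr 2
  simp
  ring

lemma shift_ne_zero {P : Polynomial ℂ} (hP : P ≠ 0) (a : ℂ) : P.comp (X - C a) ≠ 0 := by
  intro h
  apply hP
  have := congrArg (fun q => q.comp (X + C a)) h
  simpa [Polynomial.comp_assoc] using this

lemma rootImg_mul (S : AddSubgroup ℂ) {P Q : Polynomial ℂ} (hP : P ≠ 0) (hQ : Q ≠ 0) :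
    rootImg S (P * Q) = rootImg S P + rootImg S Q := by
  simp [rootImg, Polynomial.roots_mul (mul_ne_zero hP hQ)]

lemma rootImg_prod (S : AddSubgroup ℂ) {P : Polynomial ℂ} (hP : P ≠ 0) (a : ℕ → ℂ) (L : ℕ) :
    rootImg S (∏ j ∈ Finset.range L, P.comp (X - C (a j))) =
      ∑ j ∈ Finset.range L,
        (rootImg S P).map (fun z => z + (QuotientAddGroup.mk (a j) : ℂ ⧸ S)) := by
  induction L with
  | zero => simp [rootImg]
  | succ L ih =>
    rw [Finset.prod_range_succ, Finset.sum_range_succ, rootImg_mul S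
      (Finset.prod_ne_zero_iff.2 fun j _ => shift_ne_zero hP _) (shift_ne_zero hP _), ih]
    congr 1
    simp [rootImg, roots_shift, Multiset.map_map, Function.comp_def]

lemma sum_invariant {Q : Type*} [AddCommGroup Q] (M : Multiset Q) (t : Q) (L : ℕ)
    (h : L • t = 0) :
    (∑ j ∈ Finset.range L, M.map (fun z => z + j • t)).map (fun z => z + t) =
      ∑ j ∈ Finset.range L, M.map (fun z => z + j • t) := by
  have h1 : (∑ j ∈ Finset.range L, M.map (fun z => z + j • t)).map (fun z => z + t) =
      ∑ j ∈ Finset.range L, M.map (fun z => z + (j + 1) • t) := by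
    rw [← Multiset.coe_mapAddMonoidHom, map_sum]
    refine Finset.sum_congr rfl fun j _ => ?_
    simp [Multiset.map_map, Function.comp_def, add_assoc, succ_nsmul]
  rw [h1]
  have h2 := Finset.sum_range_succ (fun j => M.map (fun z => z + j • t)) L
  rw [Finset.sum_range_succ'] at h2
  simp only [h, zero_smul] at h2
  exact add_right_cancel h2

lemma key (p : ℕ) (hp : 1 ≤ p) (n : ℕ) (hn : 1 ≤ n) (F A B : Polynomial ℂ)
    (hF : F ≠ 0) (hA : A ≠ 0) (hB : B ≠ 0)
    (heq :
      (∏ i ∈ Finset.range (Nat.lcm p n / p), F.comp (X - C ((i * p : ℕ) : ℂ))) *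
        (∏ j ∈ Finset.range (Nat.lcm p n / n), B.comp (X - C ((j * n : ℕ) : ℂ)))
      = ∏ j ∈ Finset.range (Nat.lcm p n / n), A.comp (X - C ((j * n : ℕ) : ℂ))) :
    (rootImg (AddSubgroup.zmultiples (p : ℂ)) F).map
      (fun z => z + (QuotientAddGroup.mk (n : ℂ) : ℂ ⧸ AddSubgroup.zmultiples (p : ℂ))) =
      rootImg (AddSubgroup.zmultiples (p : ℂ)) F := by
  classical
  set S := AddSubgroup.zmultiples (p : ℂ) with hS
  have hmk : ∀ j k : ℕ, (QuotientAddGroup.mk ((j * k : ℕ) : ℂ) : ℂ ⧸ S) =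
      j • (QuotientAddGroup.mk (k : ℂ) : ℂ ⧸ S) := by
    intro j k
    rw [← QuotientAddGroup.mk_nsmul]
    simp
  have hp0 : (QuotientAddGroup.mk (p : ℂ) : ℂ ⧸ S) = 0 :=
    (QuotientAddGroup.eq_zero_iff _).2 (AddSubgroup.mem_zmultiples _)
  have h := congrArg (rootImg S) heq
  rw [rootImg_mul S (Finset.prod_ne_zero_iff.2 fun j _ => shift_ne_zero hF _)
    (Finset.prod_ne_zero_iff.2 fun j _ => shift_ne_zero hB _),
    rootImg_prod S hF (fun i => ((i * p : ℕ) : ℂ)), rootImg_prod S hB (fun i => ((i * n : ℕ) : ℂ)),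
    rootImg_prod S hA (fun i => ((i * n : ℕ) : ℂ))] at h
  simp only [hmk, hp0, smul_zero, add_zero, Multiset.map_id', Finset.sum_const,
    Finset.card_range] at h
  have hL : (Nat.lcm p n / n) • (QuotientAddGroup.mk (n : ℂ) : ℂ ⧸ S) = 0 := by
    rw [← hmk, Nat.div_mul_cancel (Nat.dvd_lcm_right p n),
      ← Nat.div_mul_cancel (Nat.dvd_lcm_left p n), hmk, hp0, smul_zero]
  have h' := congrArg (Multiset.map
    (fun z => z + (QuotientAddGroup.mk (n : ℂ) : ℂ ⧸ S))) h
  rw [Multiset.map_add, sum_invariant _ _ _ hL, sum_invariant _ _ _ hL, ← h] at h'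
  have h'' := add_right_cancel h'
  rw [Multiset.map_nsmul] at h''
  have hpos : 0 < Nat.lcm p n / p :=
    Nat.div_pos (Nat.le_of_dvd (Nat.lcm_pos hp hn) (Nat.dvd_lcm_left p n)) hp
  ext x
  have := congrArg (Multiset.count x) h''
  simp only [Multiset.count_nsmul] at this
  exact Nat.eq_of_mul_eq_mul_left hpos this

/-- key step in the proof of Proposition 2.5 of the paper.
Let `F(s) = κ ∏ (s − cᵢ)` of degree `p` satisfy the genericity condition (G).  If for some
`n ≥ 1` and a nonzero rational function `G = A/B` one has
`∏_{i<ℓ/p} F(s − ip) = ∏_{j<ℓ/n} G(s − jn)` with `ℓ = lcm(p,n)`, then `p ∣ n`, `ℓ = n`,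
and `G(s) = ∏_{i<n/p} F(s − ip)`. -/
theorem statement15 (p : ℕ) (hp : 1 ≤ p) (κ : ℂ) (hκ : κ ≠ 0) (cs : Fin p → ℂ)
    (hG : ∀ m : ℤ, ¬ ((p : ℤ) ∣ m) →
      Multiset.map
          (fun i => (QuotientAddGroup.mk (cs i + (m : ℂ)) :
            ℂ ⧸ AddSubgroup.zmultiples (p : ℂ)))
          (Finset.univ.val : Multiset (Fin p)) ≠
        Multiset.map
          (fun i => (QuotientAddGroup.mk (cs i) : ℂ ⧸ AddSubgroup.zmultiples (p : ℂ)))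
          (Finset.univ.val : Multiset (Fin p)))
    (n : ℕ) (hn : 1 ≤ n) (A B : Polynomial ℂ) (hA : A ≠ 0) (hB : B ≠ 0)
    (heq :
      (∏ i ∈ Finset.range (Nat.lcm p n / p),
          (Polynomial.C κ * ∏ r : Fin p, (Polynomial.X - Polynomial.C (cs r))).comp
            (Polynomial.X - Polynomial.C ((i * p : ℕ) : ℂ))) *
        (∏ j ∈ Finset.range (Nat.lcm p n / n),
          B.comp (Polynomial.X - Polynomial.C ((j * n : ℕ) : ℂ)))
      = ∏ j ∈ Finset.range (Nat.lcm p n / n),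
          A.comp (Polynomial.X - Polynomial.C ((j * n : ℕ) : ℂ))) :
    p ∣ n ∧ Nat.lcm p n = n ∧
      A = B * ∏ i ∈ Finset.range (n / p),
        (Polynomial.C κ * ∏ r : Fin p, (Polynomial.X - Polynomial.C (cs r))).comp
          (Polynomial.X - Polynomial.C ((i * p : ℕ) : ℂ)) := by
  have hF : (Polynomial.C κ * ∏ r : Fin p, (Polynomial.X - Polynomial.C (cs r))) ≠ 0 :=
    mul_ne_zero (by simpa using hκ)
      (Finset.prod_ne_zero_iff.2 fun r _ => Polynomial.X_sub_C_ne_zero _)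
  have hk := key p hp n hn _ A B hF hA hB heq
  have hpn : p ∣ n := by
    by_contra hnd
    apply hG n (by exact_mod_cast hnd)
    have hr : (Polynomial.C κ * ∏ r : Fin p, (Polynomial.X - Polynomial.C (cs r))).roots =
        (Finset.univ.val : Multiset (Fin p)).map cs := by
      rw [Polynomial.roots_C_mul _ hκ, Finset.prod_eq_multiset_prod]
      have := Polynomial.roots_multiset_prod_X_sub_C
        ((Finset.univ.val : Multiset (Fin p)).map cs)
      rwa [Multiset.map_map] at this
    simpa [rootImg, hr, Multiset.map_map, Function.comp_def] using hk
  have hl : Nat.lcm p n = n := Nat.lcm_eq_right hpn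
  refine ⟨hpn, hl, ?_⟩
  rw [hl, Nat.div_self hn] at heq
  simp only [Finset.range_one, Finset.prod_singleton, zero_mul, Nat.cast_zero,
    Polynomial.C_0, sub_zero, Polynomial.comp_X] at heq
  rw [← heq, mul_comm]
end

section
/- Let p ≥ 2 be an integer and c a real number with −1 < c < 0, and let F(s) = (∏_{i=0}^{p−2}(s − i))·(s − (p−1+cp)), a polynomial of degree p with root multiset R = {0, 1, …, p−2, p−1+cp}. Then F satisfies the genericity condition (G): for every integer m not divisible by p, the multiset {r + m : r ∈ R} and the multiset R have distinct images in ℂ/pℤ under the natural projection π_p : ℂ → ℂ/pℤ (as multisets). -/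
/-- Remark 3 of the paper.  For `p ≥ 2` and `−1 < c < 0` the root
multiset `R = {0, 1, …, p−2, p−1+cp}` of `F(s) = (∏_{i=0}^{p-2}(s−i))(s−(p−1+cp))`
satisfies the genericity condition (G): for every integer `m` not divisible by `p`, the
multisets `R + m` and `R` have distinct images in `ℂ/pℤ`. -/
theorem statement16 (p : ℕ) (hp : 2 ≤ p) (c : ℝ) (hc₁ : -1 < c) (hc₂ : c < 0) :
    ∀ m : ℤ, ¬ ((p : ℤ) ∣ m) →
      Multiset.map
          (fun r => (QuotientAddGroup.mk (r + (m : ℂ)) :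
            ℂ ⧸ AddSubgroup.zmultiples (p : ℂ)))
          (((p : ℂ) - 1 + (c : ℂ) * (p : ℂ)) ::ₘ
            (Multiset.range (p - 1)).map (fun i => (i : ℂ))) ≠
        Multiset.map
          (fun r => (QuotientAddGroup.mk r : ℂ ⧸ AddSubgroup.zmultiples (p : ℂ)))
          (((p : ℂ) - 1 + (c : ℂ) * (p : ℂ)) ::ₘ
            (Multiset.range (p - 1)).map (fun i => (i : ℂ))) := by
  intro m hm h
  have hp0 : (0 : ℤ) < p := by omega
  have hpC : (p : ℂ) ≠ 0 := by
    have : p ≠ 0 := by omega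
    exact_mod_cast this
  have key : (QuotientAddGroup.mk (-1 : ℂ) : ℂ ⧸ AddSubgroup.zmultiples (p : ℂ)) ∈
      Multiset.map
          (fun r => (QuotientAddGroup.mk (r + (m : ℂ)) :
            ℂ ⧸ AddSubgroup.zmultiples (p : ℂ)))
          (((p : ℂ) - 1 + (c : ℂ) * (p : ℂ)) ::ₘ
            (Multiset.range (p - 1)).map (fun i => (i : ℂ))) := by
    have h1 := Int.emod_nonneg (-1 - m) hp0.ne'
    have h2 := Int.emod_lt_of_pos (-1 - m) hp0
    have h3 := Int.emod_add_mul_ediv (-1 - m) p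
    have h4 : (-1 - m) % (p : ℤ) ≠ p - 1 := by
      intro h4
      apply hm
      refine ⟨-1 - (-1 - m) / p, ?_⟩
      rw [h4] at h3
      linarith
    obtain ⟨i, hi⟩ := Int.eq_ofNat_of_zero_le h1
    rw [hi] at h2 h3 h4
    rw [Multiset.mem_map]
    refine ⟨(i : ℂ), Multiset.mem_cons_of_mem (Multiset.mem_map.2 ⟨i, ?_, rfl⟩), ?_⟩
    · simp only [Multiset.bind_def, Multiset.pure_def, Multiset.mem_bind,
        Multiset.mem_singleton, Multiset.mem_range]
      exact ⟨i, by omega, rfl⟩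
    · rw [QuotientAddGroup.eq, AddSubgroup.mem_zmultiples_iff]
      refine ⟨(-1 - m) / p, ?_⟩
      have h5 : (i : ℂ) + p * (((-1 - m) / (p : ℤ) : ℤ) : ℂ) = -1 - m := by exact_mod_cast h3
      rw [zsmul_eq_mul]
      linear_combination h5
  rw [h, Multiset.mem_map] at key
  obtain ⟨r, hr, hr2⟩ := key
  rw [QuotientAddGroup.eq, AddSubgroup.mem_zmultiples_iff] at hr2
  obtain ⟨k, hk⟩ := hr2
  rw [zsmul_eq_mul] at hk
  rw [Multiset.mem_cons] at hr
  rcases hr with rfl | hr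
  · have h6 : (p : ℂ) * (c + (1 + k)) = 0 := by linear_combination hk
    have h7 : (c : ℂ) + (1 + k) = 0 := (mul_eq_zero.1 h6).resolve_left hpC
    have h8 : c + (1 + k) = 0 := by exact_mod_cast h7
    have h9 : (-1 : ℝ) < k := by linarith
    have h10 : (k : ℝ) < 0 := by linarith
    have h11 : (-1 : ℤ) < k := by exact_mod_cast h9
    have h12 : k < 0 := by exact_mod_cast h10
    omega
  · obtain ⟨j, hj, rfl⟩ := Multiset.mem_map.1 hr
    simp only [Multiset.bind_def, Multiset.pure_def, Multiset.mem_bind,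
        Multiset.mem_singleton, Multiset.mem_range] at hj
    obtain ⟨i, hi, rfl⟩ := hj
    have h6 : (k : ℂ) * p = -i - 1 := by linear_combination hk
    have h7 : k * (p : ℤ) = -i - 1 := by exact_mod_cast h6
    have h8 : (p : ℤ) ∣ (i : ℤ) + 1 := ⟨-k, by linarith⟩
    have h9 := Int.le_of_dvd (by omega) h8
    omega
end
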